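/- Let s ∈ ℂ with Re(s) > −1/2. For every x₀ > 0 there exists a constant C(x₀,s) > 0, depending only on x₀ and s, such that for all N ≥ 1 and all x > x₀, |F_N(x) − F_∞(x)| ≤ C(x₀,s)/N, where F_N is the Fredholm determinant associated with the rescaled kernel K_[N] and F_∞ is the Fredholm determinant associated with the limiting kernel K_∞ (both restricted to (0,∞)²). In particular the distribution function of the rescaled largest eigenvalue λ₁(N)/N of the generalized Cauchy ensemble converges to F_∞ at rate at least 1/N, uniformly on (x₀,∞). -/

import Mathlib

noncomputable section

open Complex MeasureTheory Filter Set

/-- Rising Pochhammer symbol `(x)_n = x(x+1)⋯(x+n−1)`. -/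
def poch (x : ℂ) (n : ℕ) : ℂ := ∏ i ∈ Finset.range n, (x + i)

/-- Confluent hypergeometric series `₁F₁[r, q; z]`. -/
def oneF1 (r q z : ℂ) : ℂ := ∑' n : ℕ, poch r n / (poch q n * n.factorial) * z ^ n

/-- Terminating Gauss hypergeometric series `₂F₁[−m, b, c; z]`. -/
def twoF1neg (m : ℕ) (b c z : ℂ) : ℂ :=
  ∑ k ∈ Finset.range (m + 1),
    poch (-(m : ℂ)) k * poch b k / (poch c k * (k.factorial : ℂ)) * z ^ k

/-- The common prefactor `|2/x|^{Re s} e^{−i/x + π Im(s) Sgn(x)/2}`. -/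
def prefac (s : ℂ) (x : ℝ) : ℂ :=
  ((|2 / x| ^ s.re : ℝ) : ℂ) *
    Complex.exp (-Complex.I / (x : ℂ) + ((Real.pi * s.im * Real.sign x / 2 : ℝ) : ℂ))

/-- `P̃(x) = |2/x|^{Re s} e^{−i/x + π Im(s) Sgn(x)/2} ₁F₁[s, 2Re(s)+1; 2i/x]`. -/
def Ptilde (s : ℂ) (x : ℝ) : ℂ :=
  prefac s x * oneF1 s ((2 * s.re + 1 : ℝ) : ℂ) (2 * Complex.I / (x : ℂ))

/-- `Q(x) = (2/x)|2/x|^{Re s} e^{−i/x + π Im(s) Sgn(x)/2} ₁F₁[s+1, 2Re(s)+2; 2i/x]`. -/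
def Qfun (s : ℂ) (x : ℝ) : ℂ :=
  (2 / (x : ℂ)) * prefac s x * oneF1 (s + 1) ((2 * s.re + 2 : ℝ) : ℂ) (2 * Complex.I / (x : ℂ))

/-- The constant in front of the limiting kernel `K_∞`. -/
def cinf (s : ℂ) : ℂ :=
  (1 / (2 * (Real.pi : ℂ))) *
    (Complex.Gamma (s + 1) * Complex.Gamma ((starRingEnd ℂ) s + 1) /
      (Complex.Gamma ((2 * s.re + 1 : ℝ) : ℂ) * Complex.Gamma ((2 * s.re + 2 : ℝ) : ℂ)))

/-- The limiting kernel `K_∞`, as a complex number (it is in fact real). -/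
def KinfC (s : ℂ) (x y : ℝ) : ℂ :=
  if x = y then cinf s * (deriv (Ptilde s) x * Qfun s x - deriv (Qfun s) x * Ptilde s x)
  else cinf s * (Ptilde s x * Qfun s y - Qfun s x * Ptilde s y) / ((x : ℂ) - (y : ℂ))

/-- The limiting kernel `K_∞` (real-valued). -/
def Kinf (s : ℂ) (x y : ℝ) : ℝ := (KinfC s x y).re

/-- The generalized Cauchy weight `w_H` on `ℝ`. -/
def wH (s : ℂ) (N : ℕ) (x : ℝ) : ℝ :=
  (1 + x ^ 2) ^ (-s.re - (N : ℝ)) * Real.exp (2 * s.im * Complex.arg (1 + Complex.I * x))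

/-- The polynomial `p_{N−1}`. -/
def pPrev (s : ℂ) (N : ℕ) (x : ℝ) : ℂ :=
  ((x : ℂ) - Complex.I) ^ (N - 1) *
    twoF1neg (N - 1) (s + 1) ((2 * s.re + 2 : ℝ) : ℂ) (2 / (1 + Complex.I * (x : ℂ)))

/-- The polynomial `p̃_N`. -/
def pTil (s : ℂ) (N : ℕ) (x : ℝ) : ℂ :=
  ((x : ℂ) - Complex.I) ^ N *
    twoF1neg N s ((2 * s.re + 1 : ℝ) : ℂ) (2 / (1 + Complex.I * (x : ℂ)))

/-- The constant `C_{N,s}`. -/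
def CNs (s : ℂ) (N : ℕ) : ℂ :=
  (((2 : ℝ) ^ (2 * s.re) / Real.pi : ℝ) : ℂ) *
    (Complex.Gamma ((2 * s.re + N + 1 : ℝ) : ℂ) * Complex.Gamma (s + 1) *
        Complex.Gamma ((starRingEnd ℂ) s + 1) /
      (Complex.Gamma (N : ℂ) * Complex.Gamma ((2 * s.re + 1 : ℝ) : ℂ) *
        Complex.Gamma ((2 * s.re + 2 : ℝ) : ℂ)))

def phiN (s : ℂ) (N : ℕ) (x : ℝ) : ℂ := pTil s N x * (Real.sqrt (wH s N x) : ℂ)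

def psiN (s : ℂ) (N : ℕ) (x : ℝ) : ℂ := pPrev s N x * (Real.sqrt (wH s N x) : ℂ)

/-- The finite-`N` kernel `K_N` (complex form; extended to the diagonal by continuity,
i.e. by the Bernoulli–l'Hôpital expression). -/
def KNC (s : ℂ) (N : ℕ) (x y : ℝ) : ℂ :=
  if x = y then CNs s N * (deriv (phiN s N) x * psiN s N x - deriv (psiN s N) x * phiN s N x)
  else CNs s N * (phiN s N x * psiN s N y - psiN s N x * phiN s N y) / ((x : ℂ) - (y : ℂ))

/-- The finite-`N` kernel `K_N` (real-valued). -/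
def KN (s : ℂ) (N : ℕ) (x y : ℝ) : ℝ := (KNC s N x y).re

/-- The rescaled kernel `K_[N](x,y) = N · K_N(Nx, Ny)`. -/
def Kscaled (s : ℂ) (N : ℕ) (x y : ℝ) : ℝ := N * KN s N (N * x) (N * y)

/-- `P̃_N`. -/
def PtildeN (s : ℂ) (N : ℕ) (x : ℝ) : ℂ :=
  (((2 : ℝ) ^ s.re : ℝ) : ℂ) *
    (Real.sqrt (Real.Gamma (2 * s.re + N + 1) / (N * Real.Gamma N)) : ℂ) *
    pTil s N (N * x) * (Real.sqrt (wH s N (N * x)) : ℂ)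

/-- `Q_N`. -/
def QN (s : ℂ) (N : ℕ) (x : ℝ) : ℂ :=
  (((2 : ℝ) ^ (s.re + 1) : ℝ) : ℂ) *
    (Real.sqrt (N * Real.Gamma (2 * s.re + N + 1) / Real.Gamma N) : ℂ) *
    pPrev s N (N * x) * (Real.sqrt (wH s N (N * x)) : ℂ)

/-- `k`-point correlation function of a kernel. -/
def rhoK (K : ℝ → ℝ → ℝ) (k : ℕ) (x : Fin k → ℝ) : ℝ :=
  Matrix.det (Matrix.of fun i j => K (x i) (x j))

/-- The Fredholm determinant of a kernel restricted to `(t,∞)²`. -/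
def fredholmDet (K : ℝ → ℝ → ℝ) (t : ℝ) : ℝ :=
  1 + ∑' k : ℕ, ((-1 : ℝ) ^ (k + 1) / (k + 1).factorial) *
    ∫ x : Fin (k + 1) → ℝ in Set.univ.pi fun _ => Set.Ioi t, rhoK K (k + 1) x

/-- Mixed partial derivative `∂^{p+q}K/∂x^p∂y^q`. -/
def pderiv₂ (K : ℝ → ℝ → ℝ) (p q : ℕ) (x y : ℝ) : ℝ :=
  iteratedDeriv p (fun x' => iteratedDeriv q (fun y' => K x' y') y) x

/-- `F_{n,h,a}(x) = ₂F₁[−n, h, a; 2/(1+ix)]` (a terminating series). -/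
def Fnha (n : ℕ) (h : ℂ) (a : ℝ) (x : ℝ) : ℂ :=
  ∑' k : ℕ, poch (-(n : ℂ)) k * poch h k / (poch (a : ℂ) k * (k.factorial : ℂ)) *
    (2 / (1 + Complex.I * (x : ℂ))) ^ k

/-- `θ(τ) = τ (d/dτ) log F(τ⁻¹)`. -/
def thetaOf (F : ℝ → ℝ) (τ : ℝ) : ℝ := τ * deriv (fun u => Real.log (F u⁻¹)) τ

/-- Squared Vandermonde determinant `∏_{j<k} (x_j − x_k)²`. -/
def vandSq (N : ℕ) (x : Fin N → ℝ) : ℝ :=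
  ∏ p ∈ Finset.univ.filter fun p : Fin N × Fin N => p.1 < p.2, (x p.1 - x p.2) ^ 2

/-- `φ(x,y) = (f(x)g(y) − g(x)f(y))/(x−y)`, extended to the diagonal. -/
def phiFG (f g : ℝ → ℝ) (x y : ℝ) : ℝ :=
  if x = y then deriv f x * g x - deriv g x * f x else (f x * g y - g x * f y) / (x - y)

/-- Perturbation form of Hadamard's determinant inequality. -/
lemma abs_det_sub_det_le {n : ℕ} {M ε : ℝ} (A B : Matrix (Fin n) (Fin n) ℝ)
    (hM : 0 ≤ M) (hε : 0 ≤ ε) (hA : ∀ i j, |A i j| ≤ M) (hB : ∀ i j, |B i j| ≤ M)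
    (hAB : ∀ i j, |A i j - B i j| ≤ ε) :
    |A.det - B.det| ≤ n * (√n * M) ^ (n - 1) * (√n * ε) := by
  have row_norm : ∀ (v : Fin n → ℝ) (c : ℝ), 0 ≤ c → (∀ j, |v j| ≤ c) →
      ‖(WithLp.toLp 2 v : EuclideanSpace ℝ (Fin n))‖ ≤ √n * c := by
    intro v c hc hv
    rw [EuclideanSpace.norm_eq]
    calc √(∑ i, ‖v i‖ ^ 2) ≤ √(∑ _i : Fin n, c ^ 2) := by
          gcongr with i
          exact hv i
      _ = √n * c := by
          rw [Finset.sum_const, Finset.card_univ, Fintype.card_fin, nsmul_eq_mul,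
            Real.sqrt_mul (Nat.cast_nonneg n), Real.sqrt_sq hc]
  let b := EuclideanSpace.basisFun (Fin n) ℝ
  have : Fact (Module.finrank ℝ (EuclideanSpace ℝ (Fin n)) = n) := ⟨by simp⟩
  let rows : Matrix (Fin n) (Fin n) ℝ → Fin n → EuclideanSpace ℝ (Fin n) :=
    fun C i => WithLp.toLp 2 (C i)
  have hdet : ∀ C : Matrix (Fin n) (Fin n) ℝ, b.toBasis.det (rows C) = C.det := by
    intro C
    rw [Module.Basis.det_apply, ← Matrix.det_transpose C]
    rfl
  have hbound : ∀ m : Fin n → EuclideanSpace ℝ (Fin n),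
      ‖b.toBasis.det.toMultilinearMap m‖ ≤ 1 * ∏ i, ‖m i‖ := by
    intro m
    have h := b.toBasis.orientation.abs_volumeForm_apply_le m
    rw [b.toBasis.orientation.volumeForm_robust b rfl] at h
    simpa using h
  have key := b.toBasis.det.toMultilinearMap.norm_image_sub_le_of_bound zero_le_one hbound
    (rows A) (rows B)
  have hrowsA : ‖rows A‖ ≤ √n * M :=
    (pi_norm_le_iff_of_nonneg (by positivity)).2 fun i => row_norm _ _ hM (hA i)
  have hrowsB : ‖rows B‖ ≤ √n * M :=
    (pi_norm_le_iff_of_nonneg (by positivity)).2 fun i => row_norm _ _ hM (hB i)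
  have hrowsAB : ‖rows A - rows B‖ ≤ √n * ε :=
    (pi_norm_le_iff_of_nonneg (by positivity)).2 fun i => row_norm (A i - B i) _ hε (hAB i)
  have e1 : b.toBasis.det.toMultilinearMap (rows A) = A.det := hdet A
  have e2 : b.toBasis.det.toMultilinearMap (rows B) = B.det := hdet B
  rw [e1, e2, Real.norm_eq_abs, Fintype.card_fin, one_mul] at key
  refine key.trans ?_
  gcongr
  exact max_le hrowsA hrowsB

lemma abs_rhoK_sub_le {K L : ℝ → ℝ → ℝ} {g : ℝ → ℝ} {S : Set ℝ} {M ε : ℝ}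
    (hM : 0 ≤ M) (hε : 0 ≤ ε) (hg : ∀ x ∈ S, 0 < g x)
    (hK : ∀ x ∈ S, ∀ y ∈ S, |K x y| ≤ M * (g x * g y))
    (hL : ∀ x ∈ S, ∀ y ∈ S, |L x y| ≤ M * (g x * g y))
    (hKL : ∀ x ∈ S, ∀ y ∈ S, |K x y - L x y| ≤ ε * (g x * g y))
    (n : ℕ) (x : Fin n → ℝ) (hx : ∀ i, x i ∈ S) :
    |rhoK K n x - rhoK L n x| ≤ n * (√n * M) ^ (n - 1) * (√n * ε) * ∏ i, g (x i) ^ 2 := by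
  have factor : ∀ T : ℝ → ℝ → ℝ, rhoK T n x =
      (∏ i, g (x i) ^ 2) *
        (Matrix.of fun i j => T (x i) (x j) / (g (x i) * g (x j))).det := by
    intro T
    have h1 := Matrix.det_mul_row (fun j => g (x j))
      (Matrix.of fun i j => T (x i) (x j) / (g (x i) * g (x j)))
    have h2 := Matrix.det_mul_column (fun i => g (x i))
      (Matrix.of fun i j => g (x j) *
        (Matrix.of fun i j => T (x i) (x j) / (g (x i) * g (x j))) i j)
    rw [h1] at h2
    rw [rhoK, Finset.prod_pow, sq, mul_assoc, ← h2]
    congr 1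
    ext i j
    have hi := (hg _ (hx i)).ne'
    have hj := (hg _ (hx j)).ne'
    simp only [Matrix.of_apply]
    field_simp
  have entry : ∀ (c B : ℝ) (i j : Fin n), |c| ≤ B * (g (x i) * g (x j)) →
      |c / (g (x i) * g (x j))| ≤ B := by
    intro c B i j h
    have hpos : 0 < g (x i) * g (x j) := mul_pos (hg _ (hx i)) (hg _ (hx j))
    rwa [abs_div, abs_of_pos hpos, div_le_iff₀ hpos]
  have hprod : 0 ≤ ∏ i, g (x i) ^ 2 := Finset.prod_nonneg fun i _ => sq_nonneg _
  rw [factor K, factor L, ← mul_sub, abs_mul, abs_of_nonneg hprod, mul_comm]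
  refine mul_le_mul_of_nonneg_right (abs_det_sub_det_le _ _ hM hε ?_ ?_ ?_) hprod
  · exact fun i j => entry _ _ i j (hK _ (hx i) _ (hx j))
  · exact fun i j => entry _ _ i j (hL _ (hx i) _ (hx j))
  · intro i j
    simp only [Matrix.of_apply, ← sub_div]
    exact entry _ _ i j (hKL _ (hx i) _ (hx j))

lemma measurable_rhoK {K : ℝ → ℝ → ℝ} (hK : Measurable (Function.uncurry K)) (n : ℕ) :
    Measurable (rhoK K n) := by
  unfold rhoK
  simp only [Matrix.det_apply, Matrix.of_apply]
  refine Finset.measurable_sum _ fun σ _ => Measurable.const_smul ?_ _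
  refine Finset.measurable_prod _ fun i _ => ?_
  have hij : Measurable fun x : Fin n → ℝ => (x (σ i), x i) :=
    (measurable_pi_apply (σ i)).prodMk (measurable_pi_apply i)
  exact hK.comp hij

/-- The `n`-th Hadamard bound, `n = k + 1`, in the expansion of a Fredholm determinant. -/
def hadamardTerm (M I : ℝ) (k : ℕ) : ℝ :=
  ((k + 1 : ℕ) : ℝ) * (√(k + 1 : ℕ) * M) ^ k * √(k + 1 : ℕ) * I ^ (k + 1) / (k + 1).factorial

lemma hadamardTerm_nonneg {M I : ℝ} (hM : 0 ≤ M) (hI : 0 ≤ I) (k : ℕ) :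
    0 ≤ hadamardTerm M I k := by
  unfold hadamardTerm; positivity

lemma summable_hadamardTerm {M I : ℝ} (hM : 1 ≤ M) (hI : 0 ≤ I) :
    Summable (hadamardTerm M I) := by
  set B := 2 * M * I with hB
  have hB0 : 0 ≤ B := by positivity
  have hs : Summable fun n : ℕ =>
      (Real.exp 1 * (2 * B) ^ 2) ^ n / n.factorial + (1 / 4 : ℝ) ^ n :=
    (Real.summable_pow_div_factorial _).add
      (summable_geometric_of_lt_one (by norm_num) (by norm_num))
  refine Summable.of_nonneg_of_le (hadamardTerm_nonneg (by linarith) hI) ?_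
    ((summable_nat_add_iff 1).2 hs)
  intro k
  set n := k + 1 with hn
  have hf : (0 : ℝ) < n.factorial := by exact_mod_cast n.factorial_pos
  have h1 : hadamardTerm M I k ≤ √n ^ n * B ^ n / n.factorial := by
    unfold hadamardTerm
    rw [← hn]
    refine div_le_div_of_nonneg_right ?_ hf.le
    have hn2 : (n : ℝ) ≤ 2 ^ n := by exact_mod_cast Nat.lt_two_pow_self.le
    calc (n : ℝ) * (√n * M) ^ k * √n * I ^ n = n * M ^ k * (√n ^ n * I ^ n) := by
          rw [mul_pow, hn]; ring
      _ ≤ 2 ^ n * M ^ n * (√n ^ n * I ^ n) := by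
          gcongr
          exact hn ▸ k.le_succ
      _ = √n ^ n * B ^ n := by rw [hB]; ring
  have h2 : (n : ℝ) ^ n ≤ Real.exp 1 ^ n * n.factorial := by
    have := Real.pow_div_factorial_le_exp (n : ℝ) (Nat.cast_nonneg n) n
    rw [div_le_iff₀ hf] at this
    rwa [← Real.exp_nat_mul, mul_one]
  set a := √n ^ n * (2 * B) ^ n / n.factorial
  have ha : a ^ 2 ≤ (Real.exp 1 * (2 * B) ^ 2) ^ n / n.factorial := by
    have : a ^ 2 = n ^ n * ((2 * B) ^ 2) ^ n / (n.factorial * n.factorial) := by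
      simp only [a]
      rw [div_pow, mul_pow, ← pow_mul, mul_comm n 2, pow_mul, Real.sq_sqrt (Nat.cast_nonneg n),
        ← pow_mul, mul_comm n 2, pow_mul]
      ring
    rw [this, div_le_div_iff₀ (by positivity) hf, mul_pow (Real.exp 1)]
    calc (n : ℝ) ^ n * ((2 * B) ^ 2) ^ n * n.factorial
        ≤ Real.exp 1 ^ n * n.factorial * ((2 * B) ^ 2) ^ n * n.factorial := by gcongr
      _ = _ := by ring
  have hab : √n ^ n * B ^ n / n.factorial = a * (1 / 2) ^ n := by
    simp only [a]
    rw [mul_pow 2 B, one_div, inv_pow]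
    field_simp
  have hq : ((1 / 2 : ℝ) ^ n) ^ 2 = (1 / 4) ^ n := by
    rw [← pow_mul, mul_comm, pow_mul]; norm_num
  calc hadamardTerm M I k ≤ a * (1 / 2) ^ n := h1.trans hab.le
    _ ≤ a ^ 2 + ((1 / 2) ^ n) ^ 2 := by
          nlinarith only [sq_nonneg (a - (1 / 2) ^ n), sq_nonneg a, sq_nonneg ((1 / 2 : ℝ) ^ n)]
    _ ≤ (Real.exp 1 * (2 * B) ^ 2) ^ n / n.factorial + (1 / 4 : ℝ) ^ n := by
          rw [hq]; exact add_le_add_left ha _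

/-- Two kernels dominated by `g ⊗ g` with `g ∈ L²(t, ∞)` have Fredholm determinants whose
difference is controlled by the difference of the kernels. -/
lemma abs_fredholmDet_sub_le {K L : ℝ → ℝ → ℝ} {g : ℝ → ℝ} {t M ε I : ℝ}
    (hM : 1 ≤ M) (hε : 0 ≤ ε) (hKm : Measurable (Function.uncurry K))
    (hLm : Measurable (Function.uncurry L)) (hg : ∀ x ∈ Ioi t, 0 < g x)
    (hgi : IntegrableOn (fun x => g x ^ 2) (Ioi t)) (hI : ∫ x in Ioi t, g x ^ 2 ≤ I)
    (hK : ∀ x ∈ Ioi t, ∀ y ∈ Ioi t, |K x y| ≤ M * (g x * g y))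
    (hL : ∀ x ∈ Ioi t, ∀ y ∈ Ioi t, |L x y| ≤ M * (g x * g y))
    (hKL : ∀ x ∈ Ioi t, ∀ y ∈ Ioi t, |K x y - L x y| ≤ ε * (g x * g y)) :
    |fredholmDet K t - fredholmDet L t| ≤ ε * ∑' k, hadamardTerm M I k := by
  have hM0 : 0 ≤ M := zero_le_one.trans hM
  have hI0' : 0 ≤ ∫ x in Ioi t, g x ^ 2 := integral_nonneg fun x => sq_nonneg _
  have hI0 : 0 ≤ I := hI0'.trans hI
  have hset : ∀ n : ℕ, MeasurableSet (Set.univ.pi fun _ : Fin n => Ioi t) := fun n =>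
    MeasurableSet.univ_pi fun _ => measurableSet_Ioi
  have hmeas : ∀ n : ℕ, (volume : Measure (Fin n → ℝ)).restrict
      (Set.univ.pi fun _ : Fin n => Ioi t) =
      Measure.pi fun _ => (volume : Measure ℝ).restrict (Ioi t) := fun n => by
    rw [volume_pi, Measure.restrict_pi_pi]
  have hprodi : ∀ n : ℕ, Integrable (fun x : Fin n → ℝ => ∏ i, g (x i) ^ 2)
      (volume.restrict (Set.univ.pi fun _ : Fin n => Ioi t)) := fun n => by
    rw [hmeas]
    exact Integrable.fintype_prod (f := fun _ x => g x ^ 2) fun _ => hgi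
  have hprodI : ∀ n : ℕ, ∫ x in Set.univ.pi fun _ : Fin n => Ioi t, ∏ i, g (x i) ^ 2 ≤ I ^ n :=
    fun n => by
      rw [hmeas, integral_fintype_prod_eq_pow (fun x => g x ^ 2), Fintype.card_fin]
      gcongr
  have hzero : ∀ (k : ℕ) (x : Fin (k + 1) → ℝ), rhoK (fun _ _ => 0) (k + 1) x = 0 := by
    intro k x
    exact Matrix.det_eq_zero_of_row_eq_zero 0 fun j => rfl
  have hint : ∀ T : ℝ → ℝ → ℝ, Measurable (Function.uncurry T) →
      (∀ x ∈ Ioi t, ∀ y ∈ Ioi t, |T x y| ≤ M * (g x * g y)) → ∀ k : ℕ,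
      Integrable (rhoK T (k + 1))
        (volume.restrict (Set.univ.pi fun _ : Fin (k + 1) => Ioi t)) := by
    intro T hTm hT k
    refine Integrable.mono' ((hprodi (k + 1)).const_mul
        (((k + 1 : ℕ) : ℝ) * (√(k + 1 : ℕ) * M) ^ (k + 1 - 1) * (√(k + 1 : ℕ) * M)))
      (measurable_rhoK hTm _).aestronglyMeasurable
      (ae_restrict_of_forall_mem (hset _) fun x hx => ?_)
    have := abs_rhoK_sub_le hM0 hM0 hg hT (L := fun _ _ => 0)
      (fun x hx y hy => by
        rw [abs_zero]; exact mul_nonneg hM0 (mul_pos (hg x hx) (hg y hy)).le)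
      (by simpa using hT) (k + 1) x (fun i => hx i (Set.mem_univ i))
    rwa [hzero, sub_zero] at this
  have hdiff : ∀ (T T' : ℝ → ℝ → ℝ) (δ : ℝ), 0 ≤ δ → Measurable (Function.uncurry T) →
      Measurable (Function.uncurry T') →
      (∀ x ∈ Ioi t, ∀ y ∈ Ioi t, |T x y| ≤ M * (g x * g y)) →
      (∀ x ∈ Ioi t, ∀ y ∈ Ioi t, |T' x y| ≤ M * (g x * g y)) →
      (∀ x ∈ Ioi t, ∀ y ∈ Ioi t, |T x y - T' x y| ≤ δ * (g x * g y)) → ∀ k : ℕ,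
      |((-1 : ℝ) ^ (k + 1) / (k + 1).factorial) *
          (∫ x in Set.univ.pi fun _ : Fin (k + 1) => Ioi t, rhoK T (k + 1) x) -
        ((-1 : ℝ) ^ (k + 1) / (k + 1).factorial) *
          ∫ x in Set.univ.pi fun _ : Fin (k + 1) => Ioi t, rhoK T' (k + 1) x| ≤
        δ * hadamardTerm M I k := by
    intro T T' δ hδ hTm hTm' hT hT' hTT k
    rw [← mul_sub, ← integral_sub (hint T hTm hT k) (hint T' hTm' hT' k), abs_mul, abs_div,
      abs_pow, abs_neg, abs_one, one_pow, Nat.abs_cast]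
    have h1 : |∫ x in Set.univ.pi fun _ : Fin (k + 1) => Ioi t,
        (rhoK T (k + 1) x - rhoK T' (k + 1) x)| ≤
        ∫ x in Set.univ.pi fun _ : Fin (k + 1) => Ioi t,
          ((k + 1 : ℕ) : ℝ) * (√(k + 1 : ℕ) * M) ^ (k + 1 - 1) * (√(k + 1 : ℕ) * δ) *
            ∏ i, g (x i) ^ 2 := by
      rw [← Real.norm_eq_abs]
      refine norm_integral_le_of_norm_le ((hprodi (k + 1)).const_mul _)
        (ae_restrict_of_forall_mem (hset _) fun x hx => ?_)
      exact abs_rhoK_sub_le hM0 hδ hg hT hT' hTT (k + 1) x fun i => hx i (Set.mem_univ i)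
    rw [integral_const_mul] at h1
    have h2 := h1.trans (mul_le_mul_of_nonneg_left (hprodI (k + 1)) (by positivity))
    refine (mul_le_mul_of_nonneg_left h2 (by positivity)).trans (le_of_eq ?_)
    rw [hadamardTerm, Nat.add_sub_cancel]
    ring
  have hsum : ∀ T : ℝ → ℝ → ℝ, Measurable (Function.uncurry T) →
      (∀ x ∈ Ioi t, ∀ y ∈ Ioi t, |T x y| ≤ M * (g x * g y)) →
      Summable fun k : ℕ => ((-1 : ℝ) ^ (k + 1) / (k + 1).factorial) *
        ∫ x in Set.univ.pi fun _ : Fin (k + 1) => Ioi t, rhoK T (k + 1) x := by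
    intro T hTm hT
    refine Summable.of_norm_bounded ((summable_hadamardTerm hM hI0).mul_left M) fun k => ?_
    have := hdiff T (fun _ _ => 0) M hM0 hTm measurable_const hT
      (fun x hx y hy => by
        rw [abs_zero]; exact mul_nonneg hM0 (mul_pos (hg x hx) (hg y hy)).le)
      (by simpa using hT) k
    simp only [hzero, integral_zero, mul_zero, sub_zero] at this
    exact this
  rw [fredholmDet, fredholmDet, add_sub_add_left_eq_sub,
    ← (hsum K hKm hK).tsum_sub (hsum L hLm hL), ← tsum_mul_left]
  rw [← Real.norm_eq_abs]
  exact tsum_of_norm_bounded ((summable_hadamardTerm hM hI0).mul_left ε).hasSum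
    (hdiff K L ε hε hKm hLm hK hL hKL)

/-- `f` is bounded by `K` and `K`-Lipschitz on `[0, U]`. -/
def LipBdd (U K : ℝ) (f : ℝ → ℂ) : Prop :=
  (∀ u ∈ Icc 0 U, ‖f u‖ ≤ K) ∧ ∀ u ∈ Icc 0 U, ∀ v ∈ Icc 0 U, ‖f u - f v‖ ≤ K * |u - v|

namespace LipBdd

variable {U K L : ℝ} {f g : ℝ → ℂ}

lemma mono (hf : LipBdd U K f) (h : K ≤ L) : LipBdd U L f :=
  ⟨fun u hu => (hf.1 u hu).trans h, fun u hu v hv =>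
    (hf.2 u hu v hv).trans (mul_le_mul_of_nonneg_right h (abs_nonneg _))⟩

lemma add (hf : LipBdd U K f) (hg : LipBdd U L g) : LipBdd U (K + L) fun u => f u + g u := by
  refine ⟨fun u hu => (norm_add_le _ _).trans (add_le_add (hf.1 u hu) (hg.1 u hu)),
    fun u hu v hv => ?_⟩
  rw [add_sub_add_comm, add_mul]
  exact (norm_add_le _ _).trans (add_le_add (hf.2 u hu v hv) (hg.2 u hu v hv))

lemma mul (hK : 0 ≤ K) (hL : 0 ≤ L) (hf : LipBdd U K f) (hg : LipBdd U L g) :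
    LipBdd U (2 * K * L) fun u => f u * g u := by
  have hKL : 0 ≤ K * L := mul_nonneg hK hL
  refine ⟨fun u hu => ?_, fun u hu v hv => ?_⟩
  · rw [norm_mul]
    have := mul_le_mul (hf.1 u hu) (hg.1 u hu) (norm_nonneg _) hK
    linarith
  · have h1 : ‖(f u - f v) * g u‖ ≤ K * |u - v| * L := by
      rw [norm_mul]
      exact mul_le_mul (hf.2 u hu v hv) (hg.1 u hu) (norm_nonneg _) (by positivity)
    have h2 : ‖f v * (g u - g v)‖ ≤ K * (L * |u - v|) := by
      rw [norm_mul]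
      exact mul_le_mul (hf.1 v hv) (hg.2 u hu v hv) (norm_nonneg _) hK
    calc ‖f u * g u - f v * g v‖ = ‖(f u - f v) * g u + f v * (g u - g v)‖ := by ring_nf
      _ ≤ _ := (norm_add_le _ _).trans (add_le_add h1 h2)
      _ = 2 * K * L * |u - v| := by ring

lemma const_mul (c : ℂ) (hf : LipBdd U K f) : LipBdd U (‖c‖ * K) fun u => c * f u := by
  refine ⟨fun u hu => ?_, fun u hu v hv => ?_⟩
  · rw [norm_mul]
    exact mul_le_mul_of_nonneg_left (hf.1 u hu) (norm_nonneg _)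
  · rw [← mul_sub, norm_mul, mul_assoc]
    exact mul_le_mul_of_nonneg_left (hf.2 u hu v hv) (norm_nonneg _)

lemma const (c : ℂ) : LipBdd U ‖c‖ fun _ => c :=
  ⟨fun _ _ => le_rfl, fun u _ v _ => by rw [sub_self, norm_zero]; positivity⟩

lemma pow (hK : 0 ≤ K) (hf : LipBdd U K f) (k : ℕ) :
    LipBdd U ((2 * K) ^ k) fun u => f u ^ k := by
  induction k with
  | zero => simpa using const (U := U) 1
  | succ k ih =>
    have := mul (by positivity) hK ih hf
    simp only [pow_succ]
    exact this.mono (by linarith)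

lemma pow_sub_pow (hK : 0 ≤ K) (hL : 0 ≤ L) (hf : LipBdd U K f) (hg : LipBdd U K g)
    (hfg : LipBdd U L fun u => f u - g u) (k : ℕ) :
    LipBdd U (2 * k * (2 * K) ^ (k - 1) * L) fun u => f u ^ k - g u ^ k := by
  induction k with
  | zero => simpa using const (U := U) 0
  | succ k ih =>
    have h := (mul (by positivity) hL (hf.pow hK k) hfg).add
      (mul (by positivity) hK ih hg)
    have e : (fun u => f u ^ (k + 1) - g u ^ (k + 1)) =
        fun u => f u ^ k * (f u - g u) + (f u ^ k - g u ^ k) * g u := by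
      funext u; ring
    rw [e]
    refine h.mono (le_of_eq ?_)
    rcases k with _ | k
    · simp
    · simp only [Nat.add_sub_cancel]
      push_cast
      ring

lemma tsum {F : ℕ → ℝ → ℂ} {a : ℕ → ℝ} (hF : ∀ k, LipBdd U (a k) (F k)) (ha : Summable a) :
    LipBdd U (∑' k, a k) fun u => ∑' k, F k u := by
  have hs : ∀ u ∈ Icc 0 U, Summable fun k => F k u := fun u hu =>
    Summable.of_norm_bounded ha fun k => (hF k).1 u hu
  refine ⟨fun u hu => tsum_of_norm_bounded ha.hasSum fun k => (hF k).1 u hu,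
    fun u hu v hv => ?_⟩
  rw [← (hs u hu).tsum_sub (hs v hv)]
  exact tsum_of_norm_bounded (ha.hasSum.mul_right _) fun k => (hF k).2 u hu v hv

/-- A function vanishing at `0` with derivative bounded by `K` on `[0, U]`. -/
lemma of_hasDerivAt {f' : ℝ → ℂ} (hK : 0 ≤ K) (h0 : f 0 = 0)
    (hd : ∀ u ∈ Icc 0 U, HasDerivAt f (f' u) u) (hf' : ∀ u ∈ Icc 0 U, ‖f' u‖ ≤ K) :
    LipBdd U (K * (1 + U)) f := by
  have key : ∀ u ∈ Icc 0 U, ∀ v ∈ Icc 0 U, ‖f u - f v‖ ≤ K * |u - v| := fun u hu v hv =>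
    (convex_Icc 0 U).norm_image_sub_le_of_norm_hasDerivWithin_le
      (fun w hw => (hd w hw).hasDerivWithinAt) hf' hv hu
  refine ⟨fun u hu => ?_, fun u hu v hv => ?_⟩
  · have := key u hu 0 ⟨le_rfl, hu.1.trans hu.2⟩
    rw [h0, sub_zero, sub_zero, abs_of_nonneg hu.1] at this
    have h2 : K * u ≤ K * (1 + U) := by gcongr; linarith [hu.2]
    linarith
  · refine (key u hu v hv).trans ?_
    have hU : 0 ≤ U := hu.1.trans hu.2
    gcongr
    nlinarith

end LipBdd

/-- `F N → f` at rate `1 / N` in the sense of bounded Lipschitz functions on `[0, U]`. -/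
def LipRate (U : ℝ) (F : ℕ → ℝ → ℂ) (f : ℝ → ℂ) : Prop :=
  ∃ K : ℝ, 0 ≤ K ∧ LipBdd U K f ∧ ∀ N : ℕ, 1 ≤ N →
    LipBdd U K (F N) ∧ LipBdd U (K / N) fun u => F N u - f u

namespace LipRate

variable {U : ℝ} {F G : ℕ → ℝ → ℂ} {f g : ℝ → ℂ}

lemma of_sub {K L : ℝ} (hK : 0 ≤ K) (hL : 0 ≤ L) (hf : LipBdd U K f)
    (h : ∀ N : ℕ, 1 ≤ N → LipBdd U (L / N) fun u => F N u - f u) : LipRate U F f := by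
  refine ⟨K + L, by positivity, hf.mono (by linarith), fun N hN => ⟨?_, ?_⟩⟩
  · have hN' : (1 : ℝ) ≤ N := by exact_mod_cast hN
    have := (hf.add (h N hN)).mono (add_le_add_right (div_le_self hL hN') K)
    simpa using this
  · exact (h N hN).mono (by gcongr; linarith)

lemma const (c : ℂ) : LipRate U (fun _ _ => c) fun _ => c :=
  of_sub (norm_nonneg c) le_rfl (LipBdd.const c) fun N _ => by
    simpa using LipBdd.const (U := U) 0

lemma of_const {c : ℕ → ℂ} {c' : ℂ} {K : ℝ} (hK : 0 ≤ K)
    (h : ∀ N : ℕ, 1 ≤ N → ‖c N - c'‖ ≤ K / N) :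
    LipRate U (fun N _ => c N) fun _ => c' :=
  of_sub (norm_nonneg c') hK (LipBdd.const c') fun N hN => (LipBdd.const _).mono (h N hN)

lemma add (hF : LipRate U F f) (hG : LipRate U G g) :
    LipRate U (fun N u => F N u + G N u) fun u => f u + g u := by
  obtain ⟨K, hK, hf, hF⟩ := hF
  obtain ⟨L, hL, hg, hG⟩ := hG
  refine ⟨K + L, by positivity, hf.add hg, fun N hN =>
    ⟨(hF N hN).1.add (hG N hN).1, ?_⟩⟩
  have := (hF N hN).2.add (hG N hN).2
  simp only [← add_sub_add_comm, ← add_div] at this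
  exact this

lemma mul (hF : LipRate U F f) (hG : LipRate U G g) :
    LipRate U (fun N u => F N u * G N u) fun u => f u * g u := by
  obtain ⟨K, hK, hf, hF⟩ := hF
  obtain ⟨L, hL, hg, hG⟩ := hG
  refine of_sub (K := 2 * K * L) (L := 4 * K * L) (by positivity) (by positivity)
    (hf.mul hK hL hg) fun N hN => ?_
  have h := ((hF N hN).1.mul hK (by positivity) (hG N hN).2).add
    ((hF N hN).2.mul (by positivity) hL hg)
  have e : (fun u => F N u * G N u - f u * g u) =
      fun u => F N u * (G N u - g u) + (F N u - f u) * g u := by funext u; ring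
  rw [e]
  exact h.mono (le_of_eq (by ring))

/-- Composition with a convergent sequence of entire functions of exponential type. -/
lemma powerSeries {c : ℕ → ℂ} {d : ℕ → ℕ → ℂ} {B : ℝ}
    (hc : ∀ k, ‖c k‖ ≤ B ^ k / k.factorial) (hd : ∀ N, 1 ≤ N → ∀ k, ‖d N k‖ ≤ 1)
    (hd1 : ∀ N : ℕ, 1 ≤ N → ∀ k, ‖d N k - 1‖ ≤ 4 ^ k / N) (hF : LipRate U F f) :
    LipRate U (fun N u => ∑' k, c k * d N k * F N u ^ k) fun u => ∑' k, c k * f u ^ k := by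
  obtain ⟨K, hK, hf, hF⟩ := hF
  have hs1 : Summable fun k : ℕ => ‖c k‖ * (2 * K) ^ k := by
    refine Summable.of_nonneg_of_le (fun k => by positivity) (fun k => ?_)
      (Real.summable_pow_div_factorial (B * (2 * K)))
    rw [mul_pow B, mul_div_right_comm]
    gcongr
    exact hc k
  have hs2 : Summable fun k : ℕ => ‖c k‖ * (8 * (K + 1)) ^ k * 2 := by
    refine Summable.mul_right _ (Summable.of_nonneg_of_le (fun k => by positivity) (fun k => ?_)
      (Real.summable_pow_div_factorial (B * (8 * (K + 1)))))
    rw [mul_pow B, mul_div_right_comm]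
    gcongr
    exact hc k
  have hterm : ∀ N : ℕ, 1 ≤ N → ∀ k, LipBdd U (‖c k‖ * (8 * (K + 1)) ^ k * 2 / N)
      fun u => c k * d N k * F N u ^ k - c k * f u ^ k := by
    intro N hN k
    have h1 := ((((hF N hN).1.pow hK k).const_mul (d N k - 1)).add
      (LipBdd.pow_sub_pow hK (by positivity) (hF N hN).1 hf (hF N hN).2 k)).const_mul (c k)
    have e : (fun u => c k * d N k * F N u ^ k - c k * f u ^ k) =
        fun u => c k * ((d N k - 1) * F N u ^ k + (F N u ^ k - f u ^ k)) := by funext u; ring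
    rw [e]
    refine h1.mono ?_
    rw [mul_assoc ‖c k‖ _ (2 : ℝ), mul_div_assoc ‖c k‖]
    refine mul_le_mul_of_nonneg_left ?_ (norm_nonneg (c k))
    have hk : (k : ℝ) ≤ 2 ^ k := by exact_mod_cast Nat.lt_two_pow_self.le
    have a1 : ‖d N k - 1‖ * (2 * K) ^ k ≤ (8 * (K + 1)) ^ k / N := by
      calc ‖d N k - 1‖ * (2 * K) ^ k ≤ 4 ^ k / N * (2 * (K + 1)) ^ k := by
            gcongr
            · exact hd1 N hN k
            · linarith
        _ = (8 * (K + 1)) ^ k / N := by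
            rw [div_mul_eq_mul_div, ← mul_pow]; ring_nf
    have a2 : 2 * k * (2 * K) ^ (k - 1) * (K / N) ≤ (8 * (K + 1)) ^ k / N := by
      rcases k with _ | k
      · simp
      · rw [Nat.add_sub_cancel, mul_div_assoc']
        gcongr
        calc 2 * ((k + 1 : ℕ) : ℝ) * (2 * K) ^ k * K = ((k + 1 : ℕ) : ℝ) * (2 * K) ^ (k + 1) := by
              ring
          _ ≤ 2 ^ (k + 1) * (2 * (K + 1)) ^ (k + 1) := by
              gcongr
              linarith
          _ = (4 * (K + 1)) ^ (k + 1) := by rw [← mul_pow]; ring_nf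
          _ ≤ _ := by gcongr; norm_num
    calc _ ≤ (8 * (K + 1)) ^ k / N + (8 * (K + 1)) ^ k / N := add_le_add a1 a2
      _ = _ := by ring
  have hsf : ∀ u ∈ Icc 0 U, Summable fun k => c k * f u ^ k := fun u hu =>
    Summable.of_norm_bounded hs1 fun k => ((hf.pow hK k).const_mul (c k)).1 u hu
  have hsF : ∀ N, 1 ≤ N → ∀ u ∈ Icc 0 U, Summable fun k => c k * d N k * F N u ^ k := by
    intro N hN u hu
    refine Summable.of_norm_bounded hs1 fun k => ?_
    rw [mul_right_comm, norm_mul]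
    exact (mul_le_of_le_one_right (norm_nonneg _) (hd N hN k)).trans
      (((hF N hN).1.pow hK k).const_mul (c k) |>.1 u hu)
  refine of_sub (tsum_nonneg fun k => by positivity)
    (tsum_nonneg fun k => by positivity : 0 ≤ ∑' k, ‖c k‖ * (8 * (K + 1)) ^ k * 2)
    (LipBdd.tsum (fun k => (hf.pow hK k).const_mul (c k)) hs1) fun N hN => ?_
  have h := LipBdd.tsum (hterm N hN) (hs2.div_const _)
  rw [tsum_div_const] at h
  refine ⟨fun u hu => ?_, fun u hu v hv => ?_⟩
  · beta_reduce
    rw [← (hsF N hN u hu).tsum_sub (hsf u hu)]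
    exact h.1 u hu
  · beta_reduce
    rw [← (hsF N hN u hu).tsum_sub (hsf u hu), ← (hsF N hN v hv).tsum_sub (hsf v hv)]
    exact h.2 u hu v hv

lemma exp (hF : LipRate U F f) :
    LipRate U (fun N u => Complex.exp (F N u)) fun u => Complex.exp (f u) := by
  have h := hF.powerSeries (c := fun k => 1 / (k.factorial : ℂ)) (d := fun _ _ => 1) (B := 1)
    (fun k => by simp) (fun N _ k => by simp)
    (fun N _ k => by rw [sub_self, norm_zero]; positivity)
  have e : ∀ z : ℂ, ∑' k : ℕ, 1 / (k.factorial : ℂ) * z ^ k = Complex.exp z := by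
    intro z
    rw [Complex.exp_eq_exp_ℂ, NormedSpace.exp_eq_tsum_div]
    exact tsum_congr fun k => by ring
  simpa only [mul_one, e] using h

end LipRate

/-- The kernel `(P(x)Q(y) − Q(x)P(y))/(x−y)`, extended to the diagonal by l'Hôpital's rule. -/
def wronskKernel (P Q : ℝ → ℂ) (x y : ℝ) : ℂ :=
  if x = y then deriv P x * Q x - deriv Q x * P x
  else (P x * Q y - Q x * P y) / ((x : ℂ) - (y : ℂ))

lemma wronskKernel_smul {l m c : ℂ} (hlm : l * m = c) (P Q : ℝ → ℂ) (x y : ℝ) :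
    wronskKernel (fun x => l * P x) (fun x => m * Q x) x y = c * wronskKernel P Q x y := by
  unfold wronskKernel
  rw [deriv_const_mul_field, deriv_const_mul_field, ← hlm]
  split_ifs <;> ring

lemma measurable_wronskKernel {P Q : ℝ → ℂ} (hP : Measurable P) (hQ : Measurable Q) :
    Measurable (Function.uncurry (wronskKernel P Q)) := by
  have hP' := measurable_deriv P
  have hQ' := measurable_deriv Q
  refine Measurable.ite (measurableSet_eq_fun measurable_fst measurable_snd) ?_ ?_
  · exact ((hP'.comp measurable_fst).mul (hQ.comp measurable_fst)).sub
      ((hQ'.comp measurable_fst).mul (hP.comp measurable_fst))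
  · exact (((hP.comp measurable_fst).mul (hQ.comp measurable_snd)).sub
      ((hQ.comp measurable_fst).mul (hP.comp measurable_snd))).div
      ((Complex.measurable_ofReal.comp measurable_fst).sub
        (Complex.measurable_ofReal.comp measurable_snd))

lemma tendsto_wronskKernel_diag {P Q : ℝ → ℂ} {x : ℝ} (hP : DifferentiableAt ℝ P x)
    (hQ : DifferentiableAt ℝ Q x) :
    Tendsto (wronskKernel P Q x) (nhdsWithin x {x}ᶜ) (nhds (wronskKernel P Q x x)) := by
  have h : HasDerivAt (fun y => Q x * P y - P x * Q y) (Q x * deriv P x - P x * deriv Q x) x :=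
    (hP.hasDerivAt.const_mul _).sub (hQ.hasDerivAt.const_mul _)
  have h2 := hasDerivAt_iff_tendsto_slope.1 h
  have e : wronskKernel P Q x x = Q x * deriv P x - P x * deriv Q x := by
    rw [wronskKernel, if_pos rfl]; ring
  rw [e]
  refine h2.congr' ?_
  filter_upwards [self_mem_nhdsWithin] with y hy
  have hne : x ≠ y := fun h => hy h.symm
  have hne' : (x : ℂ) - y ≠ 0 := sub_ne_zero.2 (by exact_mod_cast hne)
  have hne'' : (y : ℂ) - x ≠ 0 := sub_ne_zero.2 (by exact_mod_cast hne.symm)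
  rw [wronskKernel, if_neg hne, slope_def_module, Complex.real_smul]
  push_cast
  field_simp
  ring

/-- A bound for a kernel off the diagonal extends to the diagonal. -/
lemma norm_le_of_offDiag {T : ℝ → ℝ → ℂ} {g : ℝ → ℝ} {a ε : ℝ}
    (hT : ∀ x, a < x → Tendsto (T x) (nhdsWithin x {x}ᶜ) (nhds (T x x)))
    (hg : ∀ x, a < x → ContinuousAt g x)
    (h : ∀ x, a < x → ∀ y, a < y → x ≠ y → ‖T x y‖ ≤ ε * (g x * g y)) :
    ∀ x, a < x → ∀ y, a < y → ‖T x y‖ ≤ ε * (g x * g y) := by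
  intro x hx y hy
  rcases eq_or_ne x y with rfl | hxy
  · refine le_of_tendsto_of_tendsto (hT x hx).norm
      (((hg x hx).tendsto.mono_left nhdsWithin_le_nhds).const_mul (g x) |>.const_mul ε) ?_
    filter_upwards [self_mem_nhdsWithin, nhdsWithin_le_nhds (lt_mem_nhds hx)] with z hz hz'
    exact h x hx z hz' fun e => hz e.symm
  · exact h x hx y hy hxy

lemma wronskKernel_of_inv {P Q f g : ℝ → ℂ} {r x y : ℝ} (hx : 0 < x) (hy : 0 < y) (hxy : x ≠ y)
    (hP : ∀ x, 0 < x → P x = ((x ^ (-r) : ℝ) : ℂ) * f x⁻¹)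
    (hQ : ∀ x, 0 < x → Q x = ((x ^ (-r) : ℝ) : ℂ) * g x⁻¹) :
    wronskKernel P Q x y = ((x ^ (-r - 1) * y ^ (-r - 1) : ℝ) : ℂ) *
      wronskKernel f g y⁻¹ x⁻¹ * (-1) := by
  have hx' : (x : ℂ) ≠ 0 := by exact_mod_cast hx.ne'
  have hy' : (y : ℂ) ≠ 0 := by exact_mod_cast hy.ne'
  have hne : (x : ℂ) - y ≠ 0 := sub_ne_zero.2 (by exact_mod_cast hxy)
  have hinv : y⁻¹ ≠ x⁻¹ := fun h => hxy (inv_injective h).symm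
  rw [wronskKernel, if_neg hxy, wronskKernel, if_neg hinv, hP x hx, hP y hy, hQ x hx, hQ y hy,
    Real.rpow_sub_one hx.ne', Real.rpow_sub_one hy.ne']
  have e : ((y⁻¹ : ℝ) : ℂ) - ((x⁻¹ : ℝ) : ℂ) = (x - y) / (x * y) := by
    push_cast; field_simp
  rw [e]
  push_cast
  field_simp
  ring

lemma norm_wronskKernel_le {U K L : ℝ} {f g : ℝ → ℂ} (hK : 0 ≤ K)
    (hf : LipBdd U K f) (hg : LipBdd U L g) {u v : ℝ} (hu : u ∈ Icc 0 U) (hv : v ∈ Icc 0 U)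
    (huv : u ≠ v) : ‖wronskKernel f g u v‖ ≤ 2 * K * L := by
  have hpos : 0 < |u - v| := abs_pos.2 (sub_ne_zero.2 huv)
  rw [wronskKernel, if_neg huv, norm_div, ← Complex.ofReal_sub, Complex.norm_real,
    Real.norm_eq_abs, div_le_iff₀ hpos]
  have e : f u * g v - g u * f v = (f u - f v) * g v - (g u - g v) * f v := by ring
  have h1 : ‖(f u - f v) * g v‖ ≤ K * |u - v| * L := by
    rw [norm_mul]
    exact mul_le_mul (hf.2 u hu v hv) (hg.1 v hv) (norm_nonneg _) (by positivity)
  have h2 : ‖(g u - g v) * f v‖ ≤ L * |u - v| * K := by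
    rw [norm_mul]
    exact mul_le_mul (hg.2 u hu v hv) (hf.1 v hv) (norm_nonneg _)
      ((norm_nonneg _).trans (hg.2 u hu v hv))
  rw [e]
  linarith [norm_sub_le ((f u - f v) * g v) ((g u - g v) * f v)]

lemma norm_wronskKernel_sub_le {U K ε : ℝ} {f g f₁ g₁ : ℝ → ℂ} (hK : 0 ≤ K) (hε : 0 ≤ ε)
    (hf : LipBdd U K f) (hg : LipBdd U K g₁)
    (hff : LipBdd U ε fun u => f₁ u - f u) (hgg : LipBdd U ε fun u => g₁ u - g u)
    {u v : ℝ} (hu : u ∈ Icc 0 U) (hv : v ∈ Icc 0 U) (huv : u ≠ v) :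
    ‖wronskKernel f₁ g₁ u v - wronskKernel f g u v‖ ≤ 4 * K * ε := by
  have e : wronskKernel f₁ g₁ u v - wronskKernel f g u v =
      wronskKernel (fun u => f₁ u - f u) g₁ u v + wronskKernel f (fun u => g₁ u - g u) u v := by
    simp only [wronskKernel, if_neg huv]
    ring
  rw [e]
  linarith [norm_add_le (wronskKernel (fun u => f₁ u - f u) g₁ u v)
    (wronskKernel f (fun u => g₁ u - g u) u v), norm_wronskKernel_le hε hff hg hu hv huv,
    norm_wronskKernel_le hK hf hgg hu hv huv]

lemma differentiableAt_of_inv {P f : ℝ → ℂ} {r x : ℝ} (hx : 0 < x)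
    (hP : ∀ x, 0 < x → P x = ((x ^ (-r) : ℝ) : ℂ) * f x⁻¹) (hf : Differentiable ℝ f) :
    DifferentiableAt ℝ P x := by
  have h1 : DifferentiableAt ℝ (fun x : ℝ => ((x ^ (-r) : ℝ) : ℂ) * f x⁻¹) x := by
    refine DifferentiableAt.mul ?_ (hf.differentiableAt.comp x (differentiableAt_inv hx.ne'))
    exact (Complex.ofRealCLM.differentiableAt).comp x
      (Real.differentiableAt_rpow_const_of_ne _ hx.ne')
  refine h1.congr_of_eventuallyEq ?_
  filter_upwards [lt_mem_nhds hx] with y hy using hP y hy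

/-- Uniform convergence of kernels at rate `1 / N` from convergence of their ingredients. -/
lemma exists_wronskKernel_bound {P Q f g : ℝ → ℂ} {PN QN' F G : ℕ → ℝ → ℂ} {r x₀ : ℝ}
    (hx₀ : 0 < x₀)
    (hP : ∀ x, 0 < x → P x = ((x ^ (-r) : ℝ) : ℂ) * f x⁻¹)
    (hQ : ∀ x, 0 < x → Q x = ((x ^ (-r) : ℝ) : ℂ) * g x⁻¹)
    (hPN : ∀ N, 1 ≤ N → ∀ x, 0 < x → PN N x = ((x ^ (-r) : ℝ) : ℂ) * F N x⁻¹)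
    (hQN : ∀ N, 1 ≤ N → ∀ x, 0 < x → QN' N x = ((x ^ (-r) : ℝ) : ℂ) * G N x⁻¹)
    (hf : Differentiable ℝ f) (hg : Differentiable ℝ g)
    (hF : ∀ N, 1 ≤ N → Differentiable ℝ (F N)) (hG : ∀ N, 1 ≤ N → Differentiable ℝ (G N))
    (hFf : LipRate x₀⁻¹ F f) (hGg : LipRate x₀⁻¹ G g) :
    ∃ M : ℝ, 1 ≤ M ∧ (∀ x, x₀ < x → ∀ y, x₀ < y →
        ‖wronskKernel P Q x y‖ ≤ M * (x ^ (-r - 1) * y ^ (-r - 1))) ∧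
      ∀ N : ℕ, 1 ≤ N → ∀ x, x₀ < x → ∀ y, x₀ < y →
        ‖wronskKernel (PN N) (QN' N) x y‖ ≤ M * (x ^ (-r - 1) * y ^ (-r - 1)) ∧
        ‖wronskKernel (PN N) (QN' N) x y - wronskKernel P Q x y‖ ≤
          M / N * (x ^ (-r - 1) * y ^ (-r - 1)) := by
  obtain ⟨K, hK, hf1, hF1⟩ := hFf
  obtain ⟨L, hL, hg1, hG1⟩ := hGg
  have hcont : ∀ x, x₀ < x → ContinuousAt (fun x : ℝ => x ^ (-r - 1)) x := fun x hx =>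
    Real.continuousAt_rpow_const _ _ (Or.inl (hx₀.trans hx).ne')
  have hmem : ∀ x, x₀ < x → x⁻¹ ∈ Icc 0 x₀⁻¹ := fun x hx =>
    ⟨(inv_pos.2 (hx₀.trans hx)).le, inv_anti₀ hx₀ hx.le⟩
  have hdiag : ∀ x, x₀ < x →
      Tendsto (wronskKernel P Q x) (nhdsWithin x {x}ᶜ) (nhds (wronskKernel P Q x x)) :=
    fun x hx => tendsto_wronskKernel_diag (differentiableAt_of_inv (hx₀.trans hx) hP hf)
      (differentiableAt_of_inv (hx₀.trans hx) hQ hg)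
  have hdiagN : ∀ N, 1 ≤ N → ∀ x, x₀ < x → Tendsto (wronskKernel (PN N) (QN' N) x)
      (nhdsWithin x {x}ᶜ) (nhds (wronskKernel (PN N) (QN' N) x x)) :=
    fun N hN x hx => tendsto_wronskKernel_diag
      (differentiableAt_of_inv (hx₀.trans hx) (hPN N hN) (hF N hN))
      (differentiableAt_of_inv (hx₀.trans hx) (hQN N hN) (hG N hN))
  have hweight : ∀ x, x₀ < x → ∀ y, x₀ < y → 0 ≤ x ^ (-r - 1) * y ^ (-r - 1) := fun x hx y hy =>
    mul_nonneg (Real.rpow_nonneg (hx₀.trans hx).le _) (Real.rpow_nonneg (hx₀.trans hy).le _)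
  have hnorm : ∀ x, x₀ < x → ∀ y, x₀ < y → ∀ (w : ℂ) (c : ℝ), ‖w‖ ≤ c →
      ‖((x ^ (-r - 1) * y ^ (-r - 1) : ℝ) : ℂ) * w * (-1)‖ ≤
        c * (x ^ (-r - 1) * y ^ (-r - 1)) := by
    intro x hx y hy w c hw
    rw [norm_mul, norm_mul, Complex.norm_real, Real.norm_eq_abs, abs_of_nonneg (hweight x hx y hy),
      norm_neg, norm_one, mul_one, mul_comm]
    exact mul_le_mul_of_nonneg_right hw (hweight x hx y hy)
  set B := K + L with hB
  have hB0 : 0 ≤ B := by positivity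
  refine ⟨4 * B * B + 1, by nlinarith, ?_, fun N hN x hx y hy => ⟨?_, ?_⟩⟩
  · refine norm_le_of_offDiag hdiag hcont fun x hx y hy hxy => ?_
    rw [wronskKernel_of_inv (hx₀.trans hx) (hx₀.trans hy) hxy hP hQ]
    refine hnorm x hx y hy _ _ ?_
    refine (norm_wronskKernel_le hB0 (hf1.mono (by linarith)) (hg1.mono (by linarith : L ≤ B))
      (hmem y hy) (hmem x hx) fun h => hxy (inv_injective h).symm).trans ?_
    nlinarith
  · refine norm_le_of_offDiag (hdiagN N hN) hcont (fun x hx y hy hxy => ?_) x hx y hy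
    rw [wronskKernel_of_inv (hx₀.trans hx) (hx₀.trans hy) hxy (hPN N hN) (hQN N hN)]
    refine hnorm x hx y hy _ _ ?_
    refine (norm_wronskKernel_le hB0 ((hF1 N hN).1.mono (by linarith))
      ((hG1 N hN).1.mono (by linarith : L ≤ B))
      (hmem y hy) (hmem x hx) fun h => hxy (inv_injective h).symm).trans ?_
    nlinarith
  · refine norm_le_of_offDiag
      (T := fun x y => wronskKernel (PN N) (QN' N) x y - wronskKernel P Q x y)
      (fun x hx => (hdiagN N hN x hx).sub (hdiag x hx)) hcont (fun x hx y hy hxy => ?_) x hx y hy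
    rw [wronskKernel_of_inv (hx₀.trans hx) (hx₀.trans hy) hxy (hPN N hN) (hQN N hN),
      wronskKernel_of_inv (hx₀.trans hx) (hx₀.trans hy) hxy hP hQ, ← sub_mul, ← mul_sub]
    refine hnorm x hx y hy _ _ ?_
    refine (norm_wronskKernel_sub_le (K := B) (ε := B / N) hB0 (by positivity)
      (hf1.mono (by linarith)) ((hG1 N hN).1.mono (by linarith))
      ((hF1 N hN).2.mono (by gcongr; linarith)) ((hG1 N hN).2.mono (by gcongr; linarith))
      (hmem y hy) (hmem x hx) fun h => hxy (inv_injective h).symm).trans ?_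
    rw [← mul_div_assoc]
    gcongr
    linarith

/-- Coefficients of `₁F₁[a, q; z]`. -/
def hypCoeff (a q : ℂ) (k : ℕ) : ℂ := poch a k / (poch q k * k.factorial)

/-- The ratio between the coefficients of `₂F₁[−(N−j), a, q; ·]`, rescaled, and those of
`₁F₁[a, q; ·]`. -/
def hypRatio (j N k : ℕ) : ℂ := ∏ i ∈ Finset.range k, (1 - ((i : ℂ) + j) / N)

lemma poch_natCast_sub_eq {j N : ℕ} (hN : 1 ≤ N) (hj : j ≤ N) (k : ℕ) :
    poch (-((N - j : ℕ) : ℂ)) k = (-(N : ℂ)) ^ k * hypRatio j N k := by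
  have hN' : (N : ℂ) ≠ 0 := by exact_mod_cast (by omega : N ≠ 0)
  have hpow : (-(N : ℂ)) ^ k = ∏ _i ∈ Finset.range k, (-(N : ℂ)) := by simp
  rw [poch, hypRatio, hpow, ← Finset.prod_mul_distrib]
  refine Finset.prod_congr rfl fun i _ => ?_
  rw [Nat.cast_sub hj]
  field_simp
  ring

lemma hypRatio_eq_zero {j N k : ℕ} (hN : 1 ≤ N) (hj : j ≤ N) (hk : N - j < k) :
    hypRatio j N k = 0 := by
  have hN' : (N : ℂ) ≠ 0 := by exact_mod_cast (by omega : N ≠ 0)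
  refine Finset.prod_eq_zero (Finset.mem_range.2 hk) ?_
  rw [Nat.cast_sub hj, sub_add_cancel, div_self hN', sub_self]

lemma norm_hypRatio_le {j N : ℕ} (hN : 1 ≤ N) (hj : j ≤ N) (k : ℕ) : ‖hypRatio j N k‖ ≤ 1 := by
  rcases lt_or_ge (N - j) k with hk | hk
  · rw [hypRatio_eq_zero hN hj hk]; simp
  · rw [hypRatio, norm_prod]
    refine Finset.prod_le_one (fun i _ => norm_nonneg _) fun i hi => ?_
    have hi' : i + j ≤ N := by have := Finset.mem_range.1 hi; omega
    have hN' : (0 : ℝ) < N := by exact_mod_cast hN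
    have e : (1 - ((i : ℂ) + j) / N) = ((1 - ((i : ℝ) + j) / N : ℝ) : ℂ) := by push_cast; rfl
    have h1 : ((i : ℝ) + j) / N ≤ 1 := by
      rw [div_le_one hN']; exact_mod_cast hi'
    have h0 : 0 ≤ ((i : ℝ) + j) / N := by positivity
    rw [e, Complex.norm_real, Real.norm_eq_abs, abs_le]
    constructor <;> linarith

lemma norm_hypRatio_sub_one_le {j N : ℕ} (hN : 1 ≤ N) (hj : j ≤ N) (hj1 : j ≤ 1) (k : ℕ) :
    ‖hypRatio j N k - 1‖ ≤ 4 ^ k / N := by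
  have hN' : (0 : ℝ) < N := by exact_mod_cast hN
  have hj1' : (j : ℝ) ≤ 1 := by exact_mod_cast hj1
  induction k with
  | zero => simp [hypRatio]
  | succ k ih =>
    have e : hypRatio j N (k + 1) - 1 =
        (hypRatio j N k - 1) - hypRatio j N k * (((k : ℂ) + j) / N) := by
      rw [hypRatio, hypRatio, Finset.prod_range_succ]; ring
    have h2 : ‖hypRatio j N k * (((k : ℂ) + j) / N)‖ ≤ 1 * (((k : ℝ) + j) / N) := by
      rw [norm_mul]
      refine mul_le_mul (norm_hypRatio_le hN hj k) (le_of_eq ?_) (norm_nonneg _) zero_le_one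
      rw [norm_div, Complex.norm_natCast, ← Nat.cast_add, Complex.norm_natCast, Nat.cast_add]
    have hk : (k : ℝ) + 1 ≤ 2 ^ k := by exact_mod_cast Nat.lt_two_pow_self
    have hk4 : (2 : ℝ) ^ k ≤ 4 ^ k := by gcongr; norm_num
    rw [e]
    calc _ ≤ 4 ^ k / (N : ℝ) + 1 * (((k : ℝ) + j) / N) :=
          (norm_sub_le _ _).trans (add_le_add ih h2)
      _ = (4 ^ k + (k + j)) / N := by ring
      _ ≤ 4 ^ (k + 1) / N := by
          gcongr
          rw [pow_succ]
          linarith [pow_pos (show (0 : ℝ) < 4 by norm_num) k]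

lemma exists_hypCoeff_bound (s : ℂ) (hs : -(1 / 2 : ℝ) < s.re) (j : ℕ) :
    ∃ B : ℝ, ∀ k, ‖hypCoeff (s + j) ((2 * s.re + 1 + j : ℝ) : ℂ) k‖ ≤ B ^ k / k.factorial := by
  have hq : 0 < 2 * s.re + 1 := by linarith
  refine ⟨‖s‖ / (2 * s.re + 1) + 1, fun k => ?_⟩
  rw [hypCoeff, ← div_div, norm_div, Complex.norm_natCast]
  gcongr
  rw [poch, poch, ← Finset.prod_div_distrib, norm_prod]
  refine (Finset.prod_le_prod (fun i _ => norm_nonneg _)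
    (g := fun _ => ‖s‖ / (2 * s.re + 1) + 1) fun i _ => ?_).trans (by simp)
  have e : (((2 * s.re + 1 + j : ℝ) : ℂ) + i) = ((2 * s.re + 1 + j + i : ℝ) : ℂ) := by
    push_cast; rfl
  have hpos : 0 < 2 * s.re + 1 + j + i := by positivity
  rw [e, norm_div, Complex.norm_real, Real.norm_eq_abs, abs_of_pos hpos, div_le_iff₀ hpos]
  have h1 : ‖s + j + i‖ ≤ ‖s‖ + j + i := by
    refine (norm_add_le _ _).trans ?_
    rw [Complex.norm_natCast]
    gcongr
    refine (norm_add_le _ _).trans ?_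
    rw [Complex.norm_natCast]
  have h2 : ‖s‖ ≤ ‖s‖ / (2 * s.re + 1) * (2 * s.re + 1 + j + i) := by
    calc ‖s‖ = ‖s‖ / (2 * s.re + 1) * (2 * s.re + 1) := by field_simp
      _ ≤ _ := by
        refine mul_le_mul_of_nonneg_left ?_ (by positivity)
        have : (0 : ℝ) ≤ j := Nat.cast_nonneg j
        have : (0 : ℝ) ≤ i := Nat.cast_nonneg i
        linarith
  rw [add_mul, one_mul]
  linarith

lemma differentiable_powerSeries {c : ℕ → ℂ} {B : ℝ} (hc : ∀ k, ‖c k‖ ≤ B ^ k / k.factorial) :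
    Differentiable ℂ fun z => ∑' k, c k * z ^ k := by
  intro z
  have h : DifferentiableOn ℂ (fun z => ∑' k, c k * z ^ k) (Metric.ball 0 (‖z‖ + 1)) := by
    refine Complex.differentiableOn_tsum_of_summable_norm
      (Real.summable_pow_div_factorial (B * (‖z‖ + 1)))
      (fun k => (((differentiable_id.pow k).const_mul (c k)).differentiableOn))
      Metric.isOpen_ball fun k w hw => ?_
    rw [mem_ball_zero_iff] at hw
    rw [norm_mul, norm_pow, mul_pow, mul_div_right_comm]
    gcongr
    · exact (norm_nonneg _).trans (hc k)
    · exact hc k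
  exact h.differentiableAt (Metric.isOpen_ball.mem_nhds (by rw [mem_ball_zero_iff]; linarith))

lemma twoF1neg_eq_tsum {j N : ℕ} (hN : 1 ≤ N) (hj : j ≤ N) (a q z : ℂ) :
    twoF1neg (N - j) a q z = ∑' k, hypCoeff a q k * hypRatio j N k * (-(N : ℂ) * z) ^ k := by
  rw [twoF1neg, tsum_eq_sum (s := Finset.range (N - j + 1))]
  · refine Finset.sum_congr rfl fun k _ => ?_
    rw [poch_natCast_sub_eq hN hj, hypCoeff, mul_pow]
    ring
  · intro k hk
    rw [hypRatio_eq_zero hN hj (by simpa using hk)]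
    ring

/-- The regular part of the rescaled orthogonal functions at inverse distance `u` from the
origin. -/
def regN (s : ℂ) (j N : ℕ) (u : ℝ) : ℂ :=
  Complex.exp (-Complex.I * (N - j) * Real.arctan (u / N)
      - ((s.re + j) / 2) * Real.log (1 + (u / N) ^ 2) - s.im * Real.arctan (u / N)) *
    ∑' k, hypCoeff (s + j) ((2 * s.re + 1 + j : ℝ) : ℂ) k * hypRatio j N k *
      (2 * Complex.I * u * (1 - Complex.I * (u / N))⁻¹) ^ k

/-- The limit of `regN`. -/
def regInf (s : ℂ) (j : ℕ) (u : ℝ) : ℂ :=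
  Complex.exp (-Complex.I * u) *
    ∑' k, hypCoeff (s + j) ((2 * s.re + 1 + j : ℝ) : ℂ) k * (2 * Complex.I * u) ^ k

lemma one_sub_I_mul_ne_zero (x : ℝ) : (1 : ℂ) - Complex.I * x ≠ 0 := by
  intro h
  simpa using congrArg Complex.re h

lemma differentiable_regInf {s : ℂ} (hs : -(1 / 2 : ℝ) < s.re) (j : ℕ) :
    Differentiable ℝ (regInf s j) := by
  obtain ⟨B, hB⟩ := exists_hypCoeff_bound s hs j
  have h1 : Differentiable ℝ fun u : ℝ => (u : ℂ) := Complex.ofRealCLM.differentiable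
  refine (h1.const_mul _).cexp.mul ?_
  exact ((differentiable_powerSeries hB).restrictScalars ℝ).comp (h1.const_mul _)

lemma differentiable_regN {s : ℂ} (hs : -(1 / 2 : ℝ) < s.re) {j N : ℕ} (hN : 1 ≤ N)
    (hj : j ≤ N) : Differentiable ℝ (regN s j N) := by
  obtain ⟨B, hB⟩ := exists_hypCoeff_bound s hs j
  have h1 : Differentiable ℝ fun u : ℝ => (u : ℂ) := Complex.ofRealCLM.differentiable
  have hat : Differentiable ℝ fun u : ℝ => ((Real.arctan (u / N) : ℝ) : ℂ) :=
    h1.comp (differentiable_id.div_const _).arctan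
  have hlog : Differentiable ℝ fun u : ℝ => ((Real.log (1 + (u / N) ^ 2) : ℝ) : ℂ) := by
    refine h1.comp (Differentiable.log ?_ fun u => by positivity)
    fun_prop
  have hinv : Differentiable ℝ fun u : ℝ => (1 - Complex.I * ((u : ℂ) / N))⁻¹ := by
    refine Differentiable.inv ?_ fun u => ?_
    · exact (differentiable_const _).sub ((h1.div_const _).const_mul _)
    · simpa using one_sub_I_mul_ne_zero (u / N)
  refine Differentiable.mul (Differentiable.cexp
    (((hat.const_mul _).sub (hlog.const_mul _)).sub (hat.const_mul _))) ?_
  have hB' : ∀ k, ‖hypCoeff (s + j) ((2 * s.re + 1 + j : ℝ) : ℂ) k * hypRatio j N k‖ ≤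
      B ^ k / k.factorial := fun k => by
    rw [norm_mul]
    exact (mul_le_of_le_one_right (norm_nonneg _) (norm_hypRatio_le hN hj k)).trans (hB k)
  exact ((differentiable_powerSeries hB').restrictScalars ℝ).comp
    ((h1.const_mul (2 * Complex.I)).mul hinv)

lemma lipRate_of_hasDerivAt {U K L : ℝ} {F F' : ℕ → ℝ → ℂ} {f : ℝ → ℂ} (hU : 0 ≤ U) (hK : 0 ≤ K)
    (hL : 0 ≤ L) (hf : LipBdd U K f) (h0 : ∀ N, F N 0 = f 0)
    (hd : ∀ N, 1 ≤ N → ∀ u ∈ Icc 0 U, HasDerivAt (fun u => F N u - f u) (F' N u) u)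
    (hF' : ∀ N : ℕ, 1 ≤ N → ∀ u ∈ Icc 0 U, ‖F' N u‖ ≤ L / N) : LipRate U F f := by
  refine LipRate.of_sub (L := L * (1 + U)) hK (by positivity) hf fun N hN => ?_
  have := LipBdd.of_hasDerivAt (by positivity) (by simp [h0]) (hd N hN) (hF' N hN)
  rwa [div_mul_eq_mul_div] at this

lemma lipBdd_ofReal {U : ℝ} (hU : 0 ≤ U) : LipBdd U (1 + U) fun u => (u : ℂ) := by
  refine ⟨fun u hu => ?_, fun u hu v hv => ?_⟩
  · rw [Complex.norm_real, Real.norm_eq_abs, abs_of_nonneg hu.1]; linarith [hu.2]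
  · rw [← Complex.ofReal_sub, Complex.norm_real, Real.norm_eq_abs]
    exact le_mul_of_one_le_left (abs_nonneg _) (by linarith)

lemma lipRate_ofReal {U : ℝ} (hU : 0 ≤ U) : LipRate U (fun _ u => (u : ℂ)) fun u => (u : ℂ) :=
  LipRate.of_sub (by positivity) le_rfl (lipBdd_ofReal hU) fun N _ => by
    simpa using LipBdd.const (U := U) 0

lemma lipRate_mul_arctan {U : ℝ} (hU : 0 ≤ U) :
    LipRate U (fun N u => (N : ℂ) * (Real.arctan (u / N) : ℝ)) fun u => (u : ℂ) := by
  refine lipRate_of_hasDerivAt (L := U ^ 2)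
    (F' := fun N u => ((1 / (1 + (u / N) ^ 2) - 1 : ℝ) : ℂ)) hU (by positivity)
    (by positivity) (lipBdd_ofReal hU) (fun N => by simp) (fun N hN u hu => ?_)
    fun N hN u hu => ?_
  · have hN' : (N : ℝ) ≠ 0 := by exact_mod_cast (by omega : N ≠ 0)
    have h := ((((hasDerivAt_id u).div_const (N : ℝ)).arctan.const_mul (N : ℝ)).sub
      (hasDerivAt_id u)).ofReal_comp
    convert h using 1
    · funext v; simp
    · simp only [id]
      congr 2
      field_simp
  · have hN1 : (1 : ℝ) ≤ N := by exact_mod_cast hN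
    have hpos : 0 < 1 + (u / N) ^ 2 := by positivity
    have e : 1 / (1 + (u / N) ^ 2) - 1 = -((u / N) ^ 2 / (1 + (u / N) ^ 2)) := by
      field_simp; ring
    rw [Complex.norm_real, Real.norm_eq_abs, e, abs_neg, abs_of_nonneg (by positivity)]
    calc (u / N) ^ 2 / (1 + (u / N) ^ 2) ≤ (u / N) ^ 2 :=
          div_le_self (by positivity) (by linarith [sq_nonneg (u / (N : ℝ))])
      _ = u ^ 2 / (N * N) := by rw [div_pow, sq (N : ℝ)]
      _ ≤ U ^ 2 / N := by
          have := hu.1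
          have := hu.2
          gcongr
          nlinarith

lemma lipRate_inv_natCast {U : ℝ} : LipRate U (fun N _ => (N : ℂ)⁻¹) fun _ => 0 :=
  LipRate.of_const zero_le_one fun N _ => by simp

lemma lipRate_congr {U : ℝ} {F G : ℕ → ℝ → ℂ} {f g : ℝ → ℂ} (hF : LipRate U F f)
    (h : ∀ N, 1 ≤ N → F N = G N) (hfg : f = g) : LipRate U G g := by
  obtain ⟨K, hK, h1, h2⟩ := hF
  exact ⟨K, hK, hfg ▸ h1, fun N hN => h N hN ▸ hfg ▸ h2 N hN⟩

lemma lipRate_arctan {U : ℝ} (hU : 0 ≤ U) :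
    LipRate U (fun N u => ((Real.arctan (u / N) : ℝ) : ℂ)) fun _ => 0 := by
  refine lipRate_congr (lipRate_inv_natCast.mul (lipRate_mul_arctan hU)) (fun N hN => ?_)
    (by funext u; simp)
  have hN' : (N : ℂ) ≠ 0 := by exact_mod_cast (by omega : N ≠ 0)
  funext u
  field_simp

lemma lipRate_log {U : ℝ} (hU : 0 ≤ U) :
    LipRate U (fun N u => ((Real.log (1 + (u / N) ^ 2) : ℝ) : ℂ)) fun _ => 0 := by
  refine lipRate_of_hasDerivAt (K := 0) (L := 2 * U)
    (F' := fun N u => ((2 * (u / N) * (1 / N) / (1 + (u / N) ^ 2) : ℝ) : ℂ)) hU le_rfl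
    (by positivity) (by simpa using LipBdd.const (U := U) 0) (fun N => by simp)
    (fun N hN u hu => ?_) fun N hN u hu => ?_
  · have h1 : HasDerivAt (fun u : ℝ => 1 + (u / N) ^ 2) (2 * (u / N) * (1 / N)) u := by
      simpa using ((((hasDerivAt_id u).div_const (N : ℝ)).pow 2).const_add 1)
    have h := (h1.log (by positivity)).ofReal_comp
    simpa using h
  · have hN1 : (1 : ℝ) ≤ N := by exact_mod_cast hN
    have h0 := hu.1
    rw [Complex.norm_real, Real.norm_eq_abs, abs_of_nonneg (by positivity)]
    calc 2 * (u / N) * (1 / N) / (1 + (u / N) ^ 2) ≤ 2 * (u / N) * (1 / N) :=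
          div_le_self (by positivity) (by linarith [sq_nonneg (u / (N : ℝ))])
      _ ≤ 2 * (U / 1) * (1 / N) := by
          gcongr
          exact hu.2
      _ = 2 * U / N := by ring

lemma lipRate_inv {U : ℝ} (hU : 0 ≤ U) :
    LipRate U (fun N u => (1 - Complex.I * ((u : ℂ) / N))⁻¹) fun _ => 1 := by
  refine lipRate_of_hasDerivAt (K := 1) (L := 1)
    (F' := fun N u => -(-(Complex.I * (1 / N))) / (1 - Complex.I * ((u : ℂ) / N)) ^ 2) hU
    zero_le_one zero_le_one (by simpa using LipBdd.const (U := U) 1) (fun N => by simp)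
    (fun N hN u hu => ?_) fun N hN u hu => ?_
  · have hne : (1 : ℂ) - Complex.I * ((u : ℂ) / N) ≠ 0 := by
      simpa using one_sub_I_mul_ne_zero (u / N)
    have h1 : HasDerivAt (fun u : ℝ => 1 - Complex.I * ((u : ℂ) / N))
        (-(Complex.I * (1 / N))) u := by
      simpa using ((((hasDerivAt_id u).ofReal_comp).div_const (N : ℂ)).const_mul
        Complex.I).const_sub 1
    simpa using (h1.inv hne).sub_const 1
  · have hge : 1 ≤ ‖(1 : ℂ) - Complex.I * ((u : ℂ) / N)‖ := by
      have h := Complex.abs_re_le_norm ((1 : ℂ) - Complex.I * ((u / N : ℝ) : ℂ))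
      simpa using h
    have hN1 : (1 : ℝ) ≤ N := by exact_mod_cast hN
    rw [neg_neg, norm_div, norm_mul, Complex.norm_I, one_mul, norm_div, norm_one,
      Complex.norm_natCast, norm_pow]
    exact div_le_self (by positivity) (one_le_pow₀ hge)

lemma lipRate_regN {s : ℂ} (hs : -(1 / 2 : ℝ) < s.re) {U : ℝ} (hU : 0 ≤ U) {j : ℕ}
    (hj : j ≤ 1) : LipRate U (fun N => regN s j N) (regInf s j) := by
  obtain ⟨B, hB⟩ := exists_hypCoeff_bound s hs j
  have hser := (((LipRate.const (2 * Complex.I)).mul (lipRate_ofReal hU)).mul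
    (lipRate_inv hU)).powerSeries hB
    (fun N hN k => norm_hypRatio_le hN (hj.trans hN) k)
    (fun N hN k => norm_hypRatio_sub_one_le hN (hj.trans hN) hj k)
  have hE := (((((LipRate.const (-Complex.I)).mul (lipRate_mul_arctan hU)).add
    ((LipRate.const (Complex.I * j)).mul (lipRate_arctan hU))).add
    ((LipRate.const (-(((s.re : ℂ) + j) / 2))).mul (lipRate_log hU))).add
    ((LipRate.const (-(s.im : ℂ))).mul (lipRate_arctan hU))).exp
  refine lipRate_congr (hE.mul hser) (fun N _ => ?_) ?_
  · funext u
    simp only [regN]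
    congr 2
    ring
  · funext u
    simp only [regInf]
    congr 1
    · congr 1; ring
    · exact tsum_congr fun k => by rw [mul_one]

lemma ofReal_sub_I_eq_exp {X : ℝ} (hX : 0 < X) : (X : ℂ) - Complex.I =
    Complex.exp (((Real.log X + Real.log (1 + X⁻¹ ^ 2) / 2 : ℝ) : ℂ) -
      Complex.I * Real.arctan X⁻¹) := by
  have hpos : 0 < 1 + X⁻¹ ^ 2 := by positivity
  have hsq : Real.exp (Real.log (1 + X⁻¹ ^ 2) / 2) = √(1 + X⁻¹ ^ 2) := by
    rw [Real.sqrt_eq_rpow, Real.rpow_def_of_pos hpos]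
    congr 1
    ring
  have hne : ((√(1 + X⁻¹ ^ 2) : ℝ) : ℂ) ≠ 0 := by
    exact_mod_cast (Real.sqrt_pos.2 hpos).ne'
  have hX' : (X : ℂ) ≠ 0 := by exact_mod_cast hX.ne'
  have e : -(Complex.I * Real.arctan X⁻¹) = ((-Real.arctan X⁻¹ : ℝ) : ℂ) * Complex.I := by
    push_cast; ring
  rw [sub_eq_add_neg (b := Complex.I * _), Complex.exp_add, ← Complex.ofReal_exp, Real.exp_add,
    Real.exp_log hX, hsq, e, Complex.exp_mul_I, ← Complex.ofReal_cos, ← Complex.ofReal_sin,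
    Real.cos_neg, Real.sin_neg, Real.cos_arctan, Real.sin_arctan]
  generalize √(1 + X⁻¹ ^ 2) = w at hne ⊢
  push_cast
  field_simp
  ring

lemma arg_one_add_I_mul {X : ℝ} (hX : 0 < X) :
    Complex.arg (1 + Complex.I * X) = Real.pi / 2 - Real.arctan X⁻¹ := by
  have h := Complex.arg_cos_add_sin_mul_I (θ := Real.arctan X)
    ⟨by linarith [Real.neg_pi_div_two_lt_arctan X, Real.pi_pos],
      by linarith [Real.arctan_lt_pi_div_two X, Real.pi_pos]⟩
  have hpos : 0 < √(1 + X ^ 2) := Real.sqrt_pos.2 (by positivity)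
  have e : 1 + Complex.I * X = ((√(1 + X ^ 2) : ℝ) : ℂ) *
      (Complex.cos (Real.arctan X) + Complex.sin (Real.arctan X) * Complex.I) := by
    have hne : ((√(1 + X ^ 2) : ℝ) : ℂ) ≠ 0 := by exact_mod_cast hpos.ne'
    rw [← Complex.ofReal_cos, ← Complex.ofReal_sin, Real.cos_arctan, Real.sin_arctan]
    push_cast at hne ⊢
    field_simp
  rw [e, Complex.arg_real_mul _ hpos, h, Real.arctan_inv_of_pos hX]
  ring

lemma sqrt_wH_eq_exp (s : ℂ) (N : ℕ) {X : ℝ} (hX : 0 < X) : √(wH s N X) =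
    Real.exp (-(s.re + N) * (Real.log X + Real.log (1 + X⁻¹ ^ 2) / 2) +
      s.im * (Real.pi / 2 - Real.arctan X⁻¹)) := by
  have hpos : 0 < 1 + X⁻¹ ^ 2 := by positivity
  have e : 1 + X ^ 2 = X ^ 2 * (1 + X⁻¹ ^ 2) := by field_simp; ring
  rw [wH, arg_one_add_I_mul hX, Real.rpow_def_of_pos (by positivity), ← Real.exp_add,
    Real.sqrt_eq_iff_mul_self_eq (Real.exp_pos _).le (Real.exp_pos _).le, ← Real.exp_add, e,
    Real.log_mul (by positivity) hpos.ne', Real.log_pow]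
  congr 1
  push_cast
  ring

lemma twoF1neg_mul_sqrt_wH (s : ℂ) {j N : ℕ} (hN : 1 ≤ N) (hj : j ≤ N) {x : ℝ} (hx : 0 < x) :
    (((N * x : ℝ) : ℂ) - Complex.I) ^ (N - j) *
      twoF1neg (N - j) (s + j) ((2 * s.re + 1 + j : ℝ) : ℂ)
        (2 / (1 + Complex.I * ((N * x : ℝ) : ℂ))) * (√(wH s N (N * x)) : ℂ) =
    (((N * x) ^ (-s.re - j) : ℝ) : ℂ) * ((Real.exp (Real.pi * s.im / 2) : ℝ) : ℂ) *
      regN s j N x⁻¹ := by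
  have hN0 : (0 : ℝ) < N := by exact_mod_cast hN
  have hX : 0 < N * x := by positivity
  have hxN : x⁻¹ / N = (N * x)⁻¹ := by rw [mul_inv, div_eq_mul_inv, mul_comm]
  have hz : -(N : ℂ) * (2 / (1 + Complex.I * ((N * x : ℝ) : ℂ))) =
      2 * Complex.I * (x⁻¹ : ℝ) * (1 - Complex.I * ((x⁻¹ : ℝ) / N))⁻¹ := by
    have hN' : (N : ℂ) ≠ 0 := by exact_mod_cast hN0.ne'
    have hx' : (x : ℂ) ≠ 0 := by exact_mod_cast hx.ne'
    have h1 : (1 : ℂ) - Complex.I * ((x⁻¹ : ℝ) / N) ≠ 0 := by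
      simpa using one_sub_I_mul_ne_zero (x⁻¹ / N)
    have h2 : 1 + Complex.I * ((N * x : ℝ) : ℂ) =
        Complex.I * (N * x) * (1 - Complex.I * ((x⁻¹ : ℝ) / N)) := by
      push_cast
      field_simp
      linear_combination Complex.I_sq
    rw [h2]
    generalize (1 : ℂ) - Complex.I * ((x⁻¹ : ℝ) / N) = w at h1 ⊢
    push_cast
    field_simp
    linear_combination -Complex.I_sq
  have hexp : (((N * x : ℝ) : ℂ) - Complex.I) ^ (N - j) * (√(wH s N (N * x)) : ℂ) =
      (((N * x) ^ (-s.re - j) : ℝ) : ℂ) * ((Real.exp (Real.pi * s.im / 2) : ℝ) : ℂ) *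
      Complex.exp (-Complex.I * (N - j) * Real.arctan (x⁻¹ / N)
      - ((s.re + j) / 2) * Real.log (1 + (x⁻¹ / N) ^ 2) - s.im * Real.arctan (x⁻¹ / N)) := by
    rw [ofReal_sub_I_eq_exp hX, sqrt_wH_eq_exp s N hX, ← Complex.exp_nat_mul,
      Real.rpow_def_of_pos hX, hxN, Complex.ofReal_exp, Complex.ofReal_exp, Complex.ofReal_exp,
      ← Complex.exp_add, ← Complex.exp_add, ← Complex.exp_add, Nat.cast_sub hj]
    congr 1
    push_cast
    ring
  rw [twoF1neg_eq_tsum hN hj, regN, hz, mul_right_comm, hexp, mul_assoc]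

lemma phiN_natCast_mul (s : ℂ) {N : ℕ} (hN : 1 ≤ N) {x : ℝ} (hx : 0 < x) :
    phiN s N (N * x) = (((N * x) ^ (-s.re) : ℝ) : ℂ) *
      ((Real.exp (Real.pi * s.im / 2) : ℝ) : ℂ) * regN s 0 N x⁻¹ := by
  simpa [phiN, pTil] using twoF1neg_mul_sqrt_wH s hN (Nat.zero_le N) hx

lemma psiN_natCast_mul (s : ℂ) {N : ℕ} (hN : 1 ≤ N) {x : ℝ} (hx : 0 < x) :
    psiN s N (N * x) = (((N * x) ^ (-s.re - 1) : ℝ) : ℂ) *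
      ((Real.exp (Real.pi * s.im / 2) : ℝ) : ℂ) * regN s 1 N x⁻¹ := by
  have e : 2 * s.re + 2 = 2 * s.re + 1 + (1 : ℕ) := by push_cast; ring
  have h := twoF1neg_mul_sqrt_wH s hN hN hx
  rw [psiN, pPrev, e]
  simpa using h

lemma prefac_of_pos (s : ℂ) {x : ℝ} (hx : 0 < x) : prefac s x =
    (((2 : ℝ) ^ s.re : ℝ) : ℂ) * ((x ^ (-s.re) : ℝ) : ℂ) *
      ((Real.exp (Real.pi * s.im / 2) : ℝ) : ℂ) * Complex.exp (-Complex.I * (x⁻¹ : ℝ)) := by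
  rw [prefac, abs_of_pos (by positivity), Real.sign_of_pos hx, Real.div_rpow (by norm_num) hx.le,
    Real.rpow_neg hx.le, Complex.exp_add, Complex.ofReal_exp]
  push_cast
  rw [mul_one, neg_mul, ← div_eq_mul_inv, neg_div]
  field_simp

lemma Ptilde_of_pos (s : ℂ) {x : ℝ} (hx : 0 < x) : Ptilde s x =
    (((2 : ℝ) ^ s.re : ℝ) : ℂ) * ((x ^ (-s.re) : ℝ) : ℂ) *
      ((Real.exp (Real.pi * s.im / 2) : ℝ) : ℂ) * regInf s 0 x⁻¹ := by
  rw [Ptilde, prefac_of_pos s hx, regInf, oneF1, mul_assoc]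
  simp [hypCoeff, div_eq_mul_inv]

lemma Qfun_of_pos (s : ℂ) {x : ℝ} (hx : 0 < x) : Qfun s x =
    2 * (((2 : ℝ) ^ s.re : ℝ) : ℂ) * ((x ^ (-s.re) : ℝ) : ℂ) *
      ((Real.exp (Real.pi * s.im / 2) : ℝ) : ℂ) * ((x⁻¹ : ℝ) * regInf s 1 x⁻¹) := by
  have e : 2 * s.re + 2 = 2 * s.re + 1 + (1 : ℕ) := by push_cast; ring
  rw [Qfun, prefac_of_pos s hx, regInf, oneF1, e]
  simp only [hypCoeff, div_eq_mul_inv, Nat.cast_one, Complex.ofReal_inv]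
  ring

/-- `Γ(N+a) / (Γ(N) N^a)`. -/
def gammaRatio (a : ℝ) (N : ℕ) : ℝ := Real.Gamma (N + a) / (Real.Gamma N * (N : ℝ) ^ a)

lemma abs_gammaRatio_sub_one_le {a : ℝ} (ha : 0 < a) (ha1 : a ≤ 1) {N : ℕ} (hN : 1 ≤ N) :
    |gammaRatio a N - 1| ≤ 1 / N := by
  have hN0 : (0 : ℝ) < N := by exact_mod_cast hN
  have hG : 0 < Real.Gamma N := Real.Gamma_pos_of_pos hN0
  have hGa : 0 < Real.Gamma (N + a) := Real.Gamma_pos_of_pos (by positivity)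
  have hD : 0 < Real.Gamma N * (N : ℝ) ^ a := by positivity
  have hfeq : ∀ {y : ℝ}, 0 < y →
      (Real.log ∘ Real.Gamma) (y + 1) = (Real.log ∘ Real.Gamma) y + Real.log y := fun {y} hy => by
    simp only [Function.comp]
    rw [Real.Gamma_add_one hy.ne', Real.log_mul hy.ne' (Real.Gamma_pos_of_pos hy).ne', add_comm]
  have hup : gammaRatio a N ≤ 1 := by
    rw [gammaRatio, div_le_one hD, ← Real.log_le_log_iff hGa hD,
      Real.log_mul hG.ne' (by positivity), Real.log_rpow hN0]
    exact Real.BohrMollerup.f_add_nat_le Real.convexOn_log_Gamma hfeq (by omega) ha ha1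
  have hlow : 1 - 1 / (N : ℝ) ≤ gammaRatio a N := by
    rcases Nat.lt_or_ge N 2 with h2 | h2
    · obtain rfl : N = 1 := by omega
      simp only [Nat.cast_one, div_one, sub_self]
      exact div_nonneg hGa.le hD.le
    · have hN2 : (2 : ℝ) ≤ N := by exact_mod_cast h2
      have hN1 : 0 < (N : ℝ) - 1 := by linarith
      have h := Real.BohrMollerup.f_add_nat_ge Real.convexOn_log_Gamma hfeq h2 ha
      have h' : Real.Gamma N * ((N : ℝ) - 1) ^ a ≤ Real.Gamma (N + a) := by
        rw [← Real.log_le_log_iff (by positivity) hGa, Real.log_mul hG.ne' (by positivity),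
          Real.log_rpow hN1]
        exact h
      have e : 1 - 1 / (N : ℝ) = (N - 1) / N := by field_simp
      have hb1 : ((N : ℝ) - 1) / N ≤ 1 := by rw [div_le_one hN0]; linarith
      rw [gammaRatio, le_div_iff₀ hD, e]
      calc ((N : ℝ) - 1) / N * (Real.Gamma N * (N : ℝ) ^ a)
          ≤ (((N : ℝ) - 1) / N) ^ a * (Real.Gamma N * (N : ℝ) ^ a) := by
            gcongr
            simpa using Real.rpow_le_rpow_of_exponent_ge (by positivity) hb1 ha1
        _ = Real.Gamma N * ((N : ℝ) - 1) ^ a := by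
            rw [Real.div_rpow hN1.le hN0.le]
            field_simp
        _ ≤ _ := h'
  rw [abs_le]
  constructor <;> linarith [show 0 < 1 / (N : ℝ) by positivity]

lemma gammaRatio_add_one {a : ℝ} (ha : 0 < a) {N : ℕ} (hN : 1 ≤ N) :
    gammaRatio (a + 1) N = gammaRatio a N * (1 + a / N) := by
  have hN0 : (0 : ℝ) < N := by exact_mod_cast hN
  have hG : 0 < Real.Gamma N := Real.Gamma_pos_of_pos hN0
  rw [gammaRatio, gammaRatio, ← add_assoc, Real.Gamma_add_one (by positivity),
    Real.rpow_add_one hN0.ne']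
  field_simp

lemma exists_gammaRatio_bound {a : ℝ} (ha : 0 < a) :
    ∃ C : ℝ, 0 ≤ C ∧ ∀ N : ℕ, 1 ≤ N → |gammaRatio a N - 1| ≤ C / N := by
  obtain ⟨n, hn⟩ := exists_nat_ge a
  induction n generalizing a with
  | zero => simp at hn; linarith
  | succ n ih =>
    rcases le_or_gt a 1 with h | h
    · exact ⟨1, zero_le_one, fun N hN => abs_gammaRatio_sub_one_le ha h hN⟩
    · have hb : 0 < a - 1 := by linarith
      obtain ⟨C, hC, hCN⟩ := ih hb (by push_cast at hn; linarith)
      refine ⟨C * (1 + (a - 1)) + (a - 1), by positivity, fun N hN => ?_⟩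
      have hN1 : (1 : ℝ) ≤ N := by exact_mod_cast hN
      have hR := gammaRatio_add_one hb hN
      rw [sub_add_cancel] at hR
      have e : gammaRatio a N - 1 =
          (gammaRatio (a - 1) N - 1) * (1 + (a - 1) / N) + (a - 1) / N := by rw [hR]; ring
      rw [e]
      refine (abs_add_le _ _).trans ?_
      rw [abs_mul, abs_of_nonneg (by positivity : 0 ≤ (a - 1) / (N : ℝ)),
        abs_of_nonneg (by positivity : 0 ≤ 1 + (a - 1) / (N : ℝ)), add_div, mul_div_right_comm]
      gcongr
      · exact hCN N hN
      · exact div_le_self hb.le hN1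

lemma CNs_mul_rpow {s : ℂ} {N : ℕ} (hN : 1 ≤ N) :
    CNs s N * (((N : ℝ) ^ (-(2 * s.re + 1)) : ℝ) : ℂ) =
      cinf s * (((2 : ℝ) ^ (2 * s.re + 1) : ℝ) : ℂ) * (gammaRatio (2 * s.re + 1) N : ℂ) := by
  have hN0 : (0 : ℝ) < N := by exact_mod_cast hN
  have e : 2 * s.re + N + 1 = N + (2 * s.re + 1) := by ring
  have hpow : (((N : ℝ) ^ (2 * s.re + 1) : ℝ) : ℂ) ≠ 0 := by
    exact_mod_cast (Real.rpow_pos_of_pos hN0 _).ne'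
  have hG : Complex.Gamma N ≠ 0 := by
    rw [← Complex.ofReal_natCast, Complex.Gamma_ofReal]
    exact_mod_cast (Real.Gamma_pos_of_pos hN0).ne'
  have hpi : (Real.pi : ℂ) ≠ 0 := by exact_mod_cast Real.pi_ne_zero
  rw [CNs, cinf, gammaRatio, e, Real.rpow_neg hN0.le, Real.rpow_add_one (by norm_num : (2 : ℝ) ≠ 0)]
  push_cast
  rw [← Complex.Gamma_ofReal, ← Complex.Gamma_ofReal, Complex.ofReal_natCast]
  push_cast
  field_simp

lemma lipRate_CNs {s : ℂ} (hs : -(1 / 2 : ℝ) < s.re) {U : ℝ} :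
    LipRate U (fun N _ => CNs s N * (((N : ℝ) ^ (-(2 * s.re + 1)) : ℝ) : ℂ))
      fun _ => cinf s * (((2 : ℝ) ^ (2 * s.re + 1) : ℝ) : ℂ) := by
  obtain ⟨C, hC, hCN⟩ := exists_gammaRatio_bound (a := 2 * s.re + 1) (by linarith)
  have h : LipRate U (fun N _ => (gammaRatio (2 * s.re + 1) N : ℂ)) fun _ => 1 :=
    LipRate.of_const hC fun N hN => by
      rw [← Complex.ofReal_one, ← Complex.ofReal_sub, Complex.norm_real]
      exact hCN N hN
  exact lipRate_congr ((LipRate.const _).mul h)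
    (fun N hN => by funext u; rw [CNs_mul_rpow hN]) (by simp)

lemma wronskKernel_comp_mul_left {c : ℝ} (hc : c ≠ 0) (P Q : ℝ → ℂ) (x y : ℝ) :
    wronskKernel (fun x => P (c * x)) (fun x => Q (c * x)) x y =
      c * wronskKernel P Q (c * x) (c * y) := by
  have hc' : (c : ℂ) ≠ 0 := by exact_mod_cast hc
  unfold wronskKernel
  simp only [deriv_comp_mul_left, mul_right_inj' hc, Complex.real_smul]
  split_ifs with h
  · ring
  · have hne : (x : ℂ) - y ≠ 0 := sub_ne_zero.2 (by exact_mod_cast h)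
    push_cast
    rw [← mul_sub]
    field_simp

lemma Kinf_eq_re {s l m : ℂ} (h : l * m = cinf s) (x y : ℝ) :
    Kinf s x y = (wronskKernel (fun x => l * Ptilde s x) (fun x => m * Qfun s x) x y).re := by
  rw [wronskKernel_smul h, Kinf, KinfC, wronskKernel]
  split_ifs
  · rfl
  · rw [mul_div_assoc]

lemma Kscaled_eq_re {s l m : ℂ} {N : ℕ} (hN : 1 ≤ N) (h : l * m = CNs s N) (x y : ℝ) :
    Kscaled s N x y = (wronskKernel (fun x => l * phiN s N (N * x))
      (fun x => m * psiN s N (N * x)) x y).re := by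
  have hN0 : (N : ℝ) ≠ 0 := by exact_mod_cast (by omega : N ≠ 0)
  have e : KNC s N (N * x) (N * y) =
      CNs s N * wronskKernel (phiN s N) (psiN s N) (N * x) (N * y) := by
    rw [KNC, wronskKernel]
    split_ifs
    · rfl
    · rw [mul_div_assoc]
  rw [wronskKernel_smul h (fun x => phiN s N (N * x)) (fun x => psiN s N (N * x)),
    wronskKernel_comp_mul_left hN0, Kscaled, KN, e, ← Complex.re_ofReal_mul]
  congr 1
  ring

lemma measurable_twoF1neg (m : ℕ) (b c : ℂ) : Measurable (twoF1neg m b c) :=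
  Finset.measurable_fun_sum _ fun k _ => (measurable_id.pow_const k).const_mul _

lemma measurable_wH (s : ℂ) (N : ℕ) : Measurable (wH s N) := by
  refine Measurable.mul (Measurable.pow_const (by fun_prop) _) (Measurable.exp ?_)
  exact (Complex.measurable_arg.comp (by fun_prop)).const_mul _

lemma measurable_phiN (s : ℂ) (N : ℕ) : Measurable (phiN s N) := by
  refine Measurable.mul (Measurable.mul (by fun_prop) ?_)
    (Complex.measurable_ofReal.comp (measurable_wH s N).sqrt)
  exact (measurable_twoF1neg _ _ _).comp (by fun_prop)

lemma measurable_psiN (s : ℂ) (N : ℕ) : Measurable (psiN s N) := by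
  refine Measurable.mul (Measurable.mul (by fun_prop) ?_)
    (Complex.measurable_ofReal.comp (measurable_wH s N).sqrt)
  exact (measurable_twoF1neg _ _ _).comp (by fun_prop)

lemma measurable_real_sign : Measurable Real.sign := by
  refine Measurable.ite measurableSet_Iio measurable_const ?_
  exact Measurable.ite measurableSet_Ioi measurable_const measurable_const

lemma measurable_prefac (s : ℂ) : Measurable (prefac s) := by
  have h := measurable_real_sign
  refine Measurable.mul (Complex.measurable_ofReal.comp ?_) (Measurable.cexp ?_)
  · exact Measurable.pow_const (by fun_prop) _
  · exact Measurable.add (by fun_prop) (Complex.measurable_ofReal.comp (by fun_prop))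

lemma measurable_oneF1 {s : ℂ} (hs : -(1 / 2 : ℝ) < s.re) (j : ℕ) :
    Measurable (oneF1 (s + j) ((2 * s.re + 1 + j : ℝ) : ℂ)) := by
  obtain ⟨B, hB⟩ := exists_hypCoeff_bound s hs j
  exact (differentiable_powerSeries hB).continuous.measurable

lemma measurable_Ptilde {s : ℂ} (hs : -(1 / 2 : ℝ) < s.re) : Measurable (Ptilde s) := by
  have h := measurable_oneF1 hs 0
  simp only [Nat.cast_zero, add_zero] at h
  exact (measurable_prefac s).mul (h.comp (by fun_prop))

lemma measurable_Qfun {s : ℂ} (hs : -(1 / 2 : ℝ) < s.re) : Measurable (Qfun s) := by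
  have e : 2 * s.re + 1 + (1 : ℕ) = 2 * s.re + 2 := by push_cast; ring
  have h := measurable_oneF1 hs 1
  rw [e, Nat.cast_one] at h
  exact (Measurable.mul (by fun_prop) (measurable_prefac s)).mul (h.comp (by fun_prop))

/-- The kernels are uniformly dominated by a square-integrable product, and so is their difference
at rate `1 / N`. -/
lemma exists_kernel_bound {s : ℂ} (hs : -(1 / 2 : ℝ) < s.re) {x₀ : ℝ} (hx₀ : 0 < x₀) :
    ∃ M : ℝ, 1 ≤ M ∧ (∀ x, x₀ < x → ∀ y, x₀ < y →
        |Kinf s x y| ≤ M * (x ^ (-s.re - 1) * y ^ (-s.re - 1))) ∧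
      ∀ N : ℕ, 1 ≤ N → ∀ x, x₀ < x → ∀ y, x₀ < y →
        |Kscaled s N x y| ≤ M * (x ^ (-s.re - 1) * y ^ (-s.re - 1)) ∧
        |Kscaled s N x y - Kinf s x y| ≤ M / N * (x ^ (-s.re - 1) * y ^ (-s.re - 1)) := by
  have hU : 0 ≤ x₀⁻¹ := (inv_pos.2 hx₀).le
  have hofReal : Differentiable ℝ fun u : ℝ => (u : ℂ) := Complex.ofRealCLM.differentiable
  obtain ⟨E, hE⟩ : ∃ E : ℂ, E = ((Real.exp (Real.pi * s.im / 2) : ℝ) : ℂ) := ⟨_, rfl⟩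
  obtain ⟨p, hpow⟩ : ∃ p : ℂ, p = (((2 : ℝ) ^ s.re : ℝ) : ℂ) := ⟨_, rfl⟩
  have hp : p ≠ 0 := by
    rw [hpow]
    exact_mod_cast (Real.rpow_pos_of_pos two_pos s.re).ne'
  have hp2 : (((2 : ℝ) ^ (2 * s.re + 1) : ℝ) : ℂ) = 2 * p * p := by
    rw [Real.rpow_add_one two_ne_zero, two_mul, Real.rpow_add two_pos, hpow]
    push_cast
    ring
  have hlm : (cinf s * (2 * p)) * (2 * p)⁻¹ = cinf s := by
    field_simp
  have hlmN : ∀ N : ℕ, 1 ≤ N → (CNs s N * (((N : ℝ) ^ (-s.re - 1) : ℝ) : ℂ)) *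
      (((N : ℝ) ^ (s.re + 1) : ℝ) : ℂ) = CNs s N := fun N hN => by
    have hN0 : (0 : ℝ) < N := by exact_mod_cast hN
    rw [mul_assoc, ← Complex.ofReal_mul, ← Real.rpow_add hN0]
    simp
  obtain ⟨M, hM, h1, h2⟩ := exists_wronskKernel_bound (r := s.re) hx₀
    (P := fun x => cinf s * (2 * p) * Ptilde s x)
    (Q := fun x => (2 * p)⁻¹ * Qfun s x)
    (PN := fun N x => CNs s N * (((N : ℝ) ^ (-s.re - 1) : ℝ) : ℂ) * phiN s N (N * x))
    (QN' := fun N x => (((N : ℝ) ^ (s.re + 1) : ℝ) : ℂ) * psiN s N (N * x))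
    (f := fun u => cinf s * (((2 : ℝ) ^ (2 * s.re + 1) : ℝ) : ℂ) * E * regInf s 0 u)
    (g := fun u => E * u * regInf s 1 u)
    (F := fun N u => CNs s N * (((N : ℝ) ^ (-(2 * s.re + 1)) : ℝ) : ℂ) * E * regN s 0 N u)
    (G := fun N u => E * u * regN s 1 N u)
    (fun x hx => by
      simp only [Ptilde_of_pos s hx, hp2, ← hE, ← hpow]
      ring)
    (fun x hx => by
      simp only [Qfun_of_pos s hx, ← hE, ← hpow]
      field_simp)
    (fun N hN x hx => by
      have hN0 : (0 : ℝ) < N := by exact_mod_cast hN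
      have e : -(2 * s.re + 1) = (-s.re - 1) + (-s.re) := by ring
      simp only [phiN_natCast_mul s hN hx, Real.mul_rpow hN0.le hx.le, ← hE, e, Real.rpow_add hN0]
      push_cast
      ring)
    (fun N hN x hx => by
      have hN0 : (0 : ℝ) < N := by exact_mod_cast hN
      have e : (N : ℝ) ^ (s.re + 1) * (N : ℝ) ^ (-s.re - 1) = 1 := by
        rw [← Real.rpow_add hN0]
        simp
      have e' : ((((N : ℝ) ^ (s.re + 1) : ℝ)) : ℂ) * ((((N : ℝ) ^ (-s.re - 1) : ℝ)) : ℂ) = 1 := by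
        exact_mod_cast e
      simp only [psiN_natCast_mul s hN hx, Real.mul_rpow hN0.le hx.le, ← hE,
        Real.rpow_sub_one hx.ne']
      push_cast
      linear_combination (((x ^ (-s.re) : ℝ) : ℂ) / x * E * regN s 1 N x⁻¹) * e')
    ((differentiable_regInf hs 0).const_mul _)
    ((hofReal.const_mul _).mul (differentiable_regInf hs 1))
    (fun N hN => (differentiable_regN hs hN (Nat.zero_le N)).const_mul _)
    (fun N hN => (hofReal.const_mul _).mul (differentiable_regN hs hN hN))
    (((lipRate_CNs hs).mul (LipRate.const E)).mul (lipRate_regN hs hU zero_le_one))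
    (((LipRate.const E).mul (lipRate_ofReal hU)).mul (lipRate_regN hs hU le_rfl))
  refine ⟨M, hM, fun x hx y hy => ?_, fun N hN x hx y hy => ⟨?_, ?_⟩⟩
  · rw [Kinf_eq_re hlm]
    exact (Complex.abs_re_le_norm _).trans (h1 x hx y hy)
  · rw [Kscaled_eq_re hN (hlmN N hN)]
    exact (Complex.abs_re_le_norm _).trans (h2 N hN x hx y hy).1
  · rw [Kscaled_eq_re hN (hlmN N hN), Kinf_eq_re hlm, ← Complex.sub_re]
    exact (Complex.abs_re_le_norm _).trans (h2 N hN x hx y hy).2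

lemma measurable_Kinf {s : ℂ} (hs : -(1 / 2 : ℝ) < s.re) :
    Measurable (Function.uncurry (Kinf s)) := by
  have h : Function.uncurry (Kinf s) = fun z => (Function.uncurry (wronskKernel
      (fun x => cinf s * Ptilde s x) fun x => 1 * Qfun s x) z).re := by
    funext z
    exact Kinf_eq_re (mul_one _) z.1 z.2
  rw [h]
  exact Complex.measurable_re.comp (measurable_wronskKernel
    ((measurable_Ptilde hs).const_mul _) ((measurable_Qfun hs).const_mul _))

lemma measurable_Kscaled (s : ℂ) {N : ℕ} (hN : 1 ≤ N) :
    Measurable (Function.uncurry (Kscaled s N)) := by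
  have h : Function.uncurry (Kscaled s N) = fun z => (Function.uncurry (wronskKernel
      (fun x => CNs s N * phiN s N (N * x)) fun x => 1 * psiN s N (N * x)) z).re := by
    funext z
    exact Kscaled_eq_re hN (mul_one _) z.1 z.2
  have hm : Measurable fun x : ℝ => N * x := by fun_prop
  rw [h]
  exact Complex.measurable_re.comp (measurable_wronskKernel
    (((measurable_phiN s N).comp hm).const_mul _) (((measurable_psiN s N).comp hm).const_mul _))

/-- Rate of convergence: for `Re(s) > −1/2` and every `x₀ > 0` there is a
constant `C(x₀,s) > 0` such that for all `N ≥ 1` and `x > x₀`,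
`|F_N(x) − F_∞(x)| ≤ C(x₀,s)/N`, where `F_N` and `F_∞` are the Fredholm determinants of
`K_[N]` and `K_∞` on `(x,∞)`; in particular the distribution function of `λ₁(N)/N`
converges to `F_∞` at rate at least `1/N`, uniformly on `(x₀,∞)`. -/
theorem rate_of_convergence_largest_eigenvalue (s : ℂ) (hs : -(1 / 2 : ℝ) < s.re)
    (x₀ : ℝ) (hx₀ : 0 < x₀) :
    ∃ C : ℝ, 0 < C ∧ ∀ N : ℕ, 1 ≤ N → ∀ x : ℝ, x₀ < x →
      |fredholmDet (Kscaled s N) x - fredholmDet (Kinf s) x| ≤ C / N := by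
  obtain ⟨M, hM, hKinf, hKN⟩ := exists_kernel_bound hs hx₀
  have hpos : ∀ x ∈ Ioi x₀, 0 < x ^ (-s.re - 1) := fun x hx =>
    Real.rpow_pos_of_pos (hx₀.trans hx) _
  have hint : IntegrableOn (fun x : ℝ => (x ^ (-s.re - 1)) ^ 2) (Ioi x₀) := by
    refine (integrableOn_Ioi_rpow_of_lt (a := (-s.re - 1) * 2) (by linarith) hx₀).congr_fun
      (fun x hx => ?_) measurableSet_Ioi
    simpa using Real.rpow_mul (hx₀.trans hx).le (-s.re - 1) 2
  set I := ∫ x in Ioi x₀, ((x : ℝ) ^ (-s.re - 1)) ^ 2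
  have hI : 0 ≤ I := integral_nonneg fun x => sq_nonneg _
  have hS : 0 ≤ ∑' k, hadamardTerm M I k :=
    tsum_nonneg fun k => hadamardTerm_nonneg (by linarith) hI k
  refine ⟨M * ∑' k, hadamardTerm M I k + 1, by positivity, fun N hN x hx => ?_⟩
  have hsub : Ioi x ⊆ Ioi x₀ := Ioi_subset_Ioi hx.le
  refine (abs_fredholmDet_sub_le (g := fun x => x ^ (-s.re - 1)) (ε := M / N) (I := I) hM
    (by positivity) (measurable_Kscaled s hN) (measurable_Kinf hs)
    (fun y hy => hpos y (hsub hy)) (hint.mono_set hsub)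
    (setIntegral_mono_set hint (ae_of_all _ fun _ => sq_nonneg _) hsub.eventuallyLE)
    (fun y hy z hz => (hKN N hN y (hsub hy) z (hsub hz)).1)
    (fun y hy z hz => hKinf y (hsub hy) z (hsub hz))
    (fun y hy z hz => (hKN N hN y (hsub hy) z (hsub hz)).2)).trans ?_
  rw [div_mul_eq_mul_div]
  gcongr
  linarith
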